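/- arXiv:2410.05483 — 6 statements merged into one kernel-verified Lean document; each statement's English description precedes it below -/
import Mathlib

section
/- Fix a period d > 0 and α ∈ ℝ, set α_p = α + (2π/d)p for p ∈ ℤ, and for k_m > 0 (m ∈ {u,w}) define γ_{m,p} = √(k_m² − α_p²) if α_p² ≤ k_m² and γ_{m,p} = i√(α_p² − k_m²) otherwise. Let σ̂_loc = (2 E_F e²/(ε₀ c₀))/(Γ − i h f) and σ̂_nloc = σ̂_loc Q with Q = v_F²(3f + 2i/τ)/(4f(f + i/τ)²), where E_F, e, ε₀, c₀, Γ, h, f, v_F, τ > 0, and let k₀ > 0. If X₀ > 0, then for every p ∈ ℤ the transverse-electric determinant Δ^TE_p = −iγ_{u,p} − iγ_{w,p} − ik₀σ̂_loc X₀ − ik₀σ̂_nloc X₀ α_p² is nonzero; indeed Re(iΔ^TE_p) > 0. -/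
open Real Complex

/-- The vertical wavenumber: `γ = √(k² − a²)` for propagating modes (`a² ≤ k²`) and
`γ = i√(a² − k²)` for evanescent modes. -/
noncomputable def gamC (k a : ℝ) : ℂ :=
  if a ^ 2 ≤ k ^ 2 then ((Real.sqrt (k ^ 2 - a ^ 2) : ℝ) : ℂ)
  else Complex.I * ((Real.sqrt (a ^ 2 - k ^ 2) : ℝ) : ℂ)

/-- The transverse-electric determinant
`Δ^TE_p = −iγ_{u,p} − iγ_{w,p} − ik₀σ̂_loc X₀ − ik₀σ̂_nloc X₀ α_p²`
with `α_p = α + (2π/d)p`. -/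
noncomputable def DeltaTE (d α ku kw k₀ X₀ : ℝ) (σl σn : ℂ) (p : ℤ) : ℂ :=
  -Complex.I * gamC ku (α + (2 * π / d) * p)
    - Complex.I * gamC kw (α + (2 * π / d) * p)
    - Complex.I * (k₀ : ℂ) * σl * (X₀ : ℂ)
    - Complex.I * (k₀ : ℂ) * σn * (X₀ : ℂ) * ((((α + (2 * π / d) * p) ^ 2 : ℝ)) : ℂ)

/-- The vertical wavenumber has nonnegative real part. -/
theorem gamC_re_nonneg (k a : ℝ) : 0 ≤ (gamC k a).re := by
  unfold gamC
  split_ifs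
  · simpa only [ofReal_re] using Real.sqrt_nonneg _
  · simp

/-- The real part of `i Δ^TE_p`, written with `Re γ` and the real parts of the conductivities. -/
theorem I_mul_DeltaTE_re (d α ku kw k₀ X₀ : ℝ) (σl σn : ℂ) (p : ℤ) :
    (I * DeltaTE d α ku kw k₀ X₀ σl σn p).re =
      (gamC ku (α + (2 * π / d) * p)).re + (gamC kw (α + (2 * π / d) * p)).re
        + k₀ * X₀ * σl.re + k₀ * X₀ * (α + (2 * π / d) * p) ^ 2 * σn.re := by
  have key : I * DeltaTE d α ku kw k₀ X₀ σl σn p =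
      gamC ku (α + (2 * π / d) * p) + gamC kw (α + (2 * π / d) * p)
        + ((k₀ * X₀ : ℝ) : ℂ) * σl
        + ((k₀ * X₀ * (α + (2 * π / d) * p) ^ 2 : ℝ) : ℂ) * σn := by
    unfold DeltaTE
    generalize α + (2 * π / d) * p = a
    push_cast
    linear_combination (-(gamC ku a) - gamC kw a - k₀ * σl * X₀ - k₀ * σn * X₀ * a ^ 2) * I_sq
  rw [key]
  simp only [add_re, re_ofReal_mul]

/-- The Drude quotient `A / (Γ − i h f)` lies in the open first quadrant. -/
theorem drude_re_im_pos {A Γ h f : ℝ} (hA : 0 < A) (hΓ : 0 < Γ) (hh : 0 < h) (hf : 0 < f) :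
    0 < ((A : ℂ) / ((Γ : ℂ) - I * (h : ℂ) * (f : ℂ))).re ∧
      0 < ((A : ℂ) / ((Γ : ℂ) - I * (h : ℂ) * (f : ℂ))).im := by
  have hD : 0 < Γ ^ 2 + (h * f) ^ 2 := by positivity
  have hne : (Γ : ℂ) - I * h * f ≠ 0 := fun H => by
    have := congrArg re H
    simp at this
    exact hΓ.ne' this
  have key : (A : ℂ) / ((Γ : ℂ) - I * h * f) =
      ((A / (Γ ^ 2 + (h * f) ^ 2) : ℝ) : ℂ) * (Γ + (h * f : ℝ) * I) := by
    have hD' : (Γ : ℂ) ^ 2 + (h * f) ^ 2 ≠ 0 := by exact_mod_cast hD.ne'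
    rw [div_eq_iff hne]
    push_cast
    rw [div_mul_eq_mul_div, div_mul_eq_mul_div, eq_div_iff hD']
    linear_combination (A : ℂ) * (h * f) ^ 2 * I_sq
  rw [key, re_ofReal_mul, im_ofReal_mul]
  constructor
  · simpa using mul_pos (div_pos hA hD) hΓ
  · simpa using mul_pos (div_pos hA hD) (mul_pos hh hf)

/-- The nonlocal factor `(3f + 2i/τ) / (4f (f + i/τ)²)` lies in the open fourth quadrant. -/
theorem nonlocal_factor_re_pos_im_neg {f τ : ℝ} (hf : 0 < f) (hτ : 0 < τ) :
    0 < ((3 * (f : ℂ) + 2 * I / (τ : ℂ)) / (4 * (f : ℂ) * ((f : ℂ) + I / (τ : ℂ)) ^ 2)).re ∧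
      ((3 * (f : ℂ) + 2 * I / (τ : ℂ)) / (4 * (f : ℂ) * ((f : ℂ) + I / (τ : ℂ)) ^ 2)).im < 0 := by
  obtain ⟨s, hs, hsτ⟩ : ∃ s : ℝ, 0 < s ∧ (s : ℂ) = (τ : ℂ)⁻¹ :=
    ⟨τ⁻¹, inv_pos.mpr hτ, ofReal_inv τ⟩
  rw [div_eq_mul_inv (2 * I), div_eq_mul_inv I, ← hsτ]
  have hD : 0 < 4 * f * (f ^ 2 + s ^ 2) ^ 2 := by positivity
  have hne : (f : ℂ) + I * s ≠ 0 := fun H => by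
    have := congrArg re H
    simp at this
    exact hf.ne' this
  have hfne : (f : ℂ) ≠ 0 := ofReal_ne_zero.mpr hf.ne'
  have key : (3 * (f : ℂ) + 2 * I * s) / (4 * f * (f + I * s) ^ 2) =
      (((4 * f * (f ^ 2 + s ^ 2) ^ 2)⁻¹ : ℝ) : ℂ) *
        ((3 * f ^ 3 + f * s ^ 2 : ℝ) + (-(4 * f ^ 2 * s + 2 * s ^ 3) : ℝ) * I) := by
    have hD' : 4 * (f : ℂ) * (f ^ 2 + s ^ 2) ^ 2 ≠ 0 := by exact_mod_cast hD.ne'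
    have hconj : (f : ℂ) ^ 2 + s ^ 2 = (f + I * s) * (f - I * s) := by
      linear_combination (s : ℂ) ^ 2 * I_sq
    have hnum : (3 * (f : ℂ) ^ 3 + f * s ^ 2) + -(4 * f ^ 2 * s + 2 * s ^ 3) * I =
        (3 * f + 2 * I * s) * (f - I * s) ^ 2 := by
      linear_combination (f * (s : ℂ) ^ 2 - 2 * I * s ^ 3) * I_sq
    push_cast
    rw [hnum, inv_mul_eq_div, div_eq_div_iff (by simp [hfne, hne]) hD', hconj]
    ring
  rw [key, re_ofReal_mul, im_ofReal_mul]
  constructor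
  · refine mul_pos (inv_pos.mpr hD) ?_
    simp only [add_re, re_ofReal_mul, ofReal_re, I_re, mul_zero, add_zero]
    positivity
  · refine mul_neg_of_pos_of_neg (inv_pos.mpr hD) ?_
    simp only [add_im, im_ofReal_mul, ofReal_im, I_im, mul_one, zero_add, neg_lt_zero]
    positivity

/-- With the physical BGK conductivities and `X₀ > 0`, the TE
determinant `Δ^TE_p` is nonzero for every `p ∈ ℤ`; indeed `Re(iΔ^TE_p) > 0`. -/
theorem DeltaTE_ne_zero (d α ku kw k₀ X₀ : ℝ)
    (hd : 0 < d) (hku : 0 < ku) (hkw : 0 < kw) (hk₀ : 0 < k₀) (hX₀ : 0 < X₀)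
    (EF e ε₀ c₀ Γ h f vF τ : ℝ)
    (hEF : 0 < EF) (he : 0 < e) (hε₀ : 0 < ε₀) (hc₀ : 0 < c₀)
    (hΓ : 0 < Γ) (hh : 0 < h) (hf : 0 < f) (hvF : 0 < vF) (hτ : 0 < τ)
    (σl σn Q : ℂ)
    (hσl : σl = ((2 * EF * e ^ 2 / (ε₀ * c₀) : ℝ) : ℂ) /
      ((Γ : ℂ) - Complex.I * (h : ℂ) * (f : ℂ)))
    (hQ : Q = ((vF ^ 2 : ℝ) : ℂ) *
      ((3 * (f : ℂ) + 2 * Complex.I / (τ : ℂ)) /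
        (4 * (f : ℂ) * ((f : ℂ) + Complex.I / (τ : ℂ)) ^ 2)))
    (hσn : σn = σl * Q) :
    ∀ p : ℤ, DeltaTE d α ku kw k₀ X₀ σl σn p ≠ 0 ∧
      0 < (Complex.I * DeltaTE d α ku kw k₀ X₀ σl σn p).re := by
  intro p
  suffices H : 0 < (I * DeltaTE d α ku kw k₀ X₀ σl σn p).re from
    ⟨fun h0 => by simp [h0] at H, H⟩
  have hA : 0 < 2 * EF * e ^ 2 / (ε₀ * c₀) := by positivity
  obtain ⟨hlre, hlim⟩ : 0 < σl.re ∧ 0 < σl.im := hσl ▸ drude_re_im_pos hA hΓ hh hf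
  obtain ⟨hFre, hFim⟩ := nonlocal_factor_re_pos_im_neg hf hτ
  have hQre : 0 < Q.re := by
    rw [hQ, re_ofReal_mul]
    exact mul_pos (pow_pos hvF 2) hFre
  have hQim : Q.im < 0 := by
    rw [hQ, im_ofReal_mul]
    exact mul_neg_of_pos_of_neg (pow_pos hvF 2) hFim
  have hnre : 0 < σn.re := by
    rw [hσn, mul_re]
    linarith [mul_pos hlre hQre, mul_neg_of_pos_of_neg hlim hQim]
  rw [I_mul_DeltaTE_re]
  have hu := gamC_re_nonneg ku (α + (2 * π / d) * p)
  have hw := gamC_re_nonneg kw (α + (2 * π / d) * p)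
  positivity
end

section
/- Fix a period d > 0 and α ∈ ℝ, set α_p = α + (2π/d)p for p ∈ ℤ, and for k_m > 0 (m ∈ {u,w}) define γ_{m,p} = √(k_m² − α_p²) if α_p² ≤ k_m² and γ_{m,p} = i√(α_p² − k_m²) otherwise, with k_u ≠ k_w. Let σ̂_loc = (2 E_F e²/(ε₀ c₀))/(Γ − i h f) and σ̂_nloc = σ̂_loc Q with Q = v_F²(3f + 2i/τ)/(4f(f + i/τ)²), where E_F, e, ε₀, c₀, Γ, h, f, v_F, τ > 0, and let k₀, τ_u, τ_w > 0. If X₀ > 0, then for every p ∈ ℤ the transverse-magnetic determinant Δ^TM_p = −τ_u iγ_{u,p} − τ_w iγ_{w,p} + τ_uτ_w(σ̂_loc/(ik₀))X₀ γ_{u,p}γ_{w,p} + τ_uτ_w(σ̂_nloc/(ik₀))X₀ γ_{u,p}γ_{w,p} α_p² is nonzero. -/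
open Real Complex

/-- The transverse-magnetic determinant
`Δ^TM_p = −τ_u iγ_{u,p} − τ_w iγ_{w,p} + τ_uτ_w(σ̂_loc/(ik₀))X₀γ_{u,p}γ_{w,p}
  + τ_uτ_w(σ̂_nloc/(ik₀))X₀γ_{u,p}γ_{w,p}α_p²` with `α_p = α + (2π/d)p`. -/
noncomputable def DeltaTM (d α ku kw k₀ X₀ τu τw : ℝ) (σl σn : ℂ) (p : ℤ) : ℂ :=
  -(τu : ℂ) * Complex.I * gamC ku (α + (2 * π / d) * p)
    - (τw : ℂ) * Complex.I * gamC kw (α + (2 * π / d) * p)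
    + (τu : ℂ) * (τw : ℂ) * (σl / (Complex.I * (k₀ : ℂ))) * (X₀ : ℂ) *
        gamC ku (α + (2 * π / d) * p) * gamC kw (α + (2 * π / d) * p)
    + (τu : ℂ) * (τw : ℂ) * (σn / (Complex.I * (k₀ : ℂ))) * (X₀ : ℂ) *
        gamC ku (α + (2 * π / d) * p) * gamC kw (α + (2 * π / d) * p) *
        ((((α + (2 * π / d) * p) ^ 2 : ℝ)) : ℂ)

theorem gamC_ne_zero {k a : ℝ} (hne : a ^ 2 ≠ k ^ 2) : gamC k a ≠ 0 := by
  unfold gamC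
  split_ifs with hle
  · exact Complex.ofReal_ne_zero.2 (Real.sqrt_pos.2 (sub_pos.2 (lt_of_le_of_ne hle hne))).ne'
  · exact mul_ne_zero Complex.I_ne_zero
      (Complex.ofReal_ne_zero.2 (Real.sqrt_pos.2 (sub_pos.2 (not_le.1 hle))).ne')

theorem Complex.inv_re_nonneg {z : ℂ} (hz : 0 ≤ z.re) : 0 ≤ (z⁻¹).re := by
  rw [Complex.inv_re]
  exact div_nonneg hz (Complex.normSq_nonneg z)

/-- The Drude conductivity lies in the open first quadrant. -/
theorem drude_re_pos_im_pos {A Γ b : ℝ} (hA : 0 < A) (hΓ : 0 < Γ) (hb : 0 < b) :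
    0 < ((A : ℂ) / ((Γ : ℂ) - Complex.I * b)).re ∧
      0 < ((A : ℂ) / ((Γ : ℂ) - Complex.I * b)).im := by
  have hre : ((Γ : ℂ) - Complex.I * b).re = Γ := by simp
  have him : ((Γ : ℂ) - Complex.I * b).im = -b := by simp
  have hN : 0 < Complex.normSq ((Γ : ℂ) - Complex.I * b) := by
    rw [Complex.normSq_apply, hre, him, neg_mul_neg]
    positivity
  constructor
  · rw [Complex.div_re, hre, Complex.ofReal_re, Complex.ofReal_im, zero_mul, zero_div, add_zero]
    positivity
  · rw [Complex.div_im, him, Complex.ofReal_re, Complex.ofReal_im, zero_mul, zero_div, zero_sub,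
      mul_neg, neg_div, neg_neg]
    positivity

/-- The nonlocal correction factor lies in the open fourth quadrant. -/
theorem nonlocalFactor_re_pos_im_neg {v f τ : ℝ} (hv : 0 < v) (hf : 0 < f) (hτ : 0 < τ) :
    0 < (((v ^ 2 : ℝ) : ℂ) * ((3 * (f : ℂ) + 2 * Complex.I / (τ : ℂ)) /
        (4 * (f : ℂ) * ((f : ℂ) + Complex.I / (τ : ℂ)) ^ 2))).re ∧
      (((v ^ 2 : ℝ) : ℂ) * ((3 * (f : ℂ) + 2 * Complex.I / (τ : ℂ)) /
        (4 * (f : ℂ) * ((f : ℂ) + Complex.I / (τ : ℂ)) ^ 2))).im < 0 := by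
  obtain ⟨s, hs, rfl⟩ : ∃ s : ℝ, 0 < s ∧ τ = s⁻¹ := ⟨τ⁻¹, inv_pos.2 hτ, (inv_inv τ).symm⟩
  have hpos : 0 < f ^ 2 + s ^ 2 := by positivity
  have hconj : ((f : ℂ) + Complex.I * s) * (f - Complex.I * s) = ((f ^ 2 + s ^ 2 : ℝ) : ℂ) := by
    push_cast
    linear_combination (-(s : ℂ) ^ 2) * Complex.I_sq
  have hprod : ((f : ℂ) + Complex.I * s) * (f - Complex.I * s) ≠ 0 := by
    rw [hconj]
    exact Complex.ofReal_ne_zero.2 hpos.ne'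
  have key : ((v ^ 2 : ℝ) : ℂ) * ((3 * (f : ℂ) + 2 * Complex.I / ((s⁻¹ : ℝ) : ℂ)) /
        (4 * (f : ℂ) * ((f : ℂ) + Complex.I / ((s⁻¹ : ℝ) : ℂ)) ^ 2)) =
      ((v ^ 2 / (4 * f * (f ^ 2 + s ^ 2) ^ 2) : ℝ) : ℂ) *
        (⟨3 * f ^ 3 + f * s ^ 2, -(4 * f ^ 2 * s + 2 * s ^ 3)⟩ : ℂ) := by
    have hnum : (⟨3 * f ^ 3 + f * s ^ 2, -(4 * f ^ 2 * s + 2 * s ^ 3)⟩ : ℂ) =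
        (3 * (f : ℂ) + 2 * Complex.I * s) * (f - Complex.I * s) ^ 2 := by
      rw [Complex.mk_eq_add_mul_I]
      push_cast
      linear_combination
        ((f : ℂ) * s ^ 2 - 2 * s ^ 3 * Complex.I) * Complex.I_sq
    have hden : ((v ^ 2 / (4 * f * (f ^ 2 + s ^ 2) ^ 2) : ℝ) : ℂ) =
        (v : ℂ) ^ 2 / (4 * f * (((f : ℂ) + Complex.I * s) * (f - Complex.I * s)) ^ 2) := by
      rw [hconj]
      push_cast
      rfl
    have hne' : (f : ℂ) - Complex.I * s ≠ 0 := right_ne_zero_of_mul hprod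
    rw [hnum, hden]
    simp only [Complex.ofReal_inv, div_inv_eq_mul, Complex.ofReal_pow]
    field_simp
  rw [key, Complex.re_ofReal_mul, Complex.im_ofReal_mul]
  have hr : 0 < v ^ 2 / (4 * f * (f ^ 2 + s ^ 2) ^ 2) := by positivity
  refine ⟨mul_pos hr (by positivity), mul_neg_of_pos_of_neg hr (neg_lt_zero.2 (by positivity))⟩

/-- The total conductivity symbol `σ (1 + Q x)` is dissipative when `σ` lies in the first
quadrant and `Q` in the fourth. -/
theorem re_mul_one_add_mul_pos {σ Q : ℂ} {x : ℝ} (hx : 0 ≤ x) (hσre : 0 < σ.re)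
    (hσim : 0 < σ.im) (hQre : 0 < Q.re) (hQim : Q.im < 0) : 0 < (σ * (1 + Q * x)).re := by
  rw [Complex.mul_re, Complex.add_re, Complex.add_im, Complex.one_re, Complex.one_im,
    Complex.re_mul_ofReal, Complex.im_mul_ofReal]
  have h₁ : 0 < σ.re * (1 + Q.re * x) := by positivity
  have h₂ : σ.im * (0 + Q.im * x) ≤ 0 :=
    mul_nonpos_of_nonneg_of_nonpos hσim.le
      (by simpa using mul_nonpos_of_nonpos_of_nonneg hQim.le hx)
  linarith

/-- With the physical BGK conductivities, `k_u ≠ k_w`, and `X₀ > 0`,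
the TM determinant `Δ^TM_p` is nonzero for every `p ∈ ℤ`. -/
theorem DeltaTM_ne_zero (d α ku kw k₀ X₀ τu τw : ℝ)
    (hd : 0 < d) (hku : 0 < ku) (hkw : 0 < kw) (hkuw : ku ≠ kw)
    (hk₀ : 0 < k₀) (hτu : 0 < τu) (hτw : 0 < τw) (hX₀ : 0 < X₀)
    (EF e ε₀ c₀ Γ h f vF τ : ℝ)
    (hEF : 0 < EF) (he : 0 < e) (hε₀ : 0 < ε₀) (hc₀ : 0 < c₀)
    (hΓ : 0 < Γ) (hh : 0 < h) (hf : 0 < f) (hvF : 0 < vF) (hτ : 0 < τ)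
    (σl σn Q : ℂ)
    (hσl : σl = ((2 * EF * e ^ 2 / (ε₀ * c₀) : ℝ) : ℂ) /
      ((Γ : ℂ) - Complex.I * (h : ℂ) * (f : ℂ)))
    (hQ : Q = ((vF ^ 2 : ℝ) : ℂ) *
      ((3 * (f : ℂ) + 2 * Complex.I / (τ : ℂ)) /
        (4 * (f : ℂ) * ((f : ℂ) + Complex.I / (τ : ℂ)) ^ 2)))
    (hσn : σn = σl * Q) :
    ∀ p : ℤ, DeltaTM d α ku kw k₀ X₀ τu τw σl σn p ≠ 0 := by
  intro p
  unfold DeltaTM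
  generalize α + (2 * π / d) * p = a
  obtain ⟨hσre, hσim⟩ : 0 < σl.re ∧ 0 < σl.im := by
    have hσ := drude_re_pos_im_pos (A := 2 * EF * e ^ 2 / (ε₀ * c₀)) (by positivity) hΓ
      (mul_pos hh hf)
    rwa [Complex.ofReal_mul h f, ← mul_assoc, ← hσl] at hσ
  obtain ⟨hQre, hQim⟩ : 0 < Q.re ∧ Q.im < 0 := hQ ▸ nonlocalFactor_re_pos_im_neg hvF hf hτ
  have hsymbol := re_mul_one_add_mul_pos (sq_nonneg a) hσre hσim hQre hQim
  have hsq : ku ^ 2 ≠ kw ^ 2 := fun hEq ↦ hkuw ((sq_eq_sq₀ hku.le hkw.le).1 hEq)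
  by_cases hu : gamC ku a = 0
  · have hau : a ^ 2 = ku ^ 2 := by_contra fun hne ↦ gamC_ne_zero hne hu
    have hw : gamC kw a ≠ 0 := gamC_ne_zero (hau ▸ hsq)
    simp [hu, hw, hτw.ne']
  by_cases hw : gamC kw a = 0
  · simp [hu, hw, hτu.ne']
  intro hzero
  have hsum : (τu : ℂ) * (gamC kw a)⁻¹ + τw * (gamC ku a)⁻¹ +
      ((τu * τw * X₀ / k₀ : ℝ) : ℂ) * (σl * (1 + Q * ((a ^ 2 : ℝ) : ℂ))) = 0 := by
    have hfactor : (-Complex.I * gamC ku a * gamC kw a) *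
        ((τu : ℂ) * (gamC kw a)⁻¹ + τw * (gamC ku a)⁻¹ +
          ((τu * τw * X₀ / k₀ : ℝ) : ℂ) * (σl * (1 + Q * ((a ^ 2 : ℝ) : ℂ)))) = 0 := by
      rw [← hzero, hσn]
      simp only [div_eq_mul_inv, mul_inv, Complex.inv_I]
      push_cast
      field_simp
      ring
    exact (mul_eq_zero.1 hfactor).resolve_left
      (mul_ne_zero (mul_ne_zero (neg_ne_zero.2 Complex.I_ne_zero) hu) hw)
  have hre := congrArg Complex.re hsum
  simp only [Complex.add_re, Complex.re_ofReal_mul, Complex.zero_re] at hre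
  have hτuγ := mul_nonneg hτu.le (Complex.inv_re_nonneg (gamC_re_nonneg kw a))
  have hτwγ := mul_nonneg hτw.le (Complex.inv_re_nonneg (gamC_re_nonneg ku a))
  have hcond := mul_pos (show 0 < τu * τw * X₀ / k₀ by positivity) hsymbol
  linarith
end

section
/- Let Y and Z be Banach spaces. Suppose (R_ℓ)_{ℓ≥0} ⊂ Z satisfies ‖R_ℓ‖_Z ≤ C_R B_R^ℓ for constants C_R, B_R > 0; suppose (A_ℓ)_{ℓ≥0} are bounded linear operators Y → Z with ‖A_ℓ‖_{Y→Z} ≤ C_A B_A^ℓ for constants C_A, B_A > 0; and suppose A₀ has a bounded inverse A₀⁻¹ : Z → Y with ‖A₀⁻¹‖_{Z→Y} ≤ C_e. Define V_ℓ ∈ Y recursively by V_ℓ = A₀⁻¹[R_ℓ − Σ_{q=0}^{ℓ−1} A_{ℓ−q} V_q] for ℓ ≥ 0. Then ‖V_ℓ‖_Y ≤ C_V B_V^ℓ for all ℓ ≥ 0, for any constants C_V ≥ 2 C_e C_R and B_V ≥ max{B_R, 2B_A, 4 C_e C_A B_A}. Consequently, for any 0 ≤ ρ < 1 the series V(δ)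 = Σ_{ℓ≥0} V_ℓ δ^ℓ converges in Y for all real δ with B_V δ < ρ. -/
open Real

/-- If `2a ≤ b`, the geometric convolution `∑_{q<n} a^{n-q} b^q` is at most `2 a b^{n-1}`. -/
lemma mul_sum_range_pow_sub_mul_pow_le {a b : ℝ} (ha : 0 ≤ a) (hab : 2 * a ≤ b) (n : ℕ) :
    b * ∑ q ∈ Finset.range n, a ^ (n - q) * b ^ q ≤ 2 * a * b ^ n := by
  have hb : 0 ≤ b := by linarith
  induction n with
  | zero => simpa using ha
  | succ n ih =>
    have hstep : ∑ q ∈ Finset.range (n + 1), a ^ (n + 1 - q) * b ^ q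
        = a * (∑ q ∈ Finset.range n, a ^ (n - q) * b ^ q) + a * b ^ n := by
      rw [Finset.sum_range_succ, Finset.mul_sum, Nat.add_sub_cancel_left, pow_one]
      congr 1
      refine Finset.sum_congr rfl fun q hq => ?_
      rw [Nat.sub_add_comm (Finset.mem_range.mp hq).le, pow_succ']
      ring
    rw [hstep]
    have h₁ := mul_le_mul_of_nonneg_left ih ha
    have h₂ := mul_le_mul_of_nonneg_right hab (mul_nonneg ha (pow_nonneg hb n))
    rw [pow_succ]
    linarith

/-- abstract analyticity theorem.  If `‖R_ℓ‖ ≤ C_R B_R^ℓ`,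
`‖A_ℓ‖ ≤ C_A B_A^ℓ`, `A₀` has a bounded inverse with `‖A₀⁻¹‖ ≤ C_e`, and
`V_ℓ = A₀⁻¹[R_ℓ − Σ_{q<ℓ} A_{ℓ−q}V_q]`, then `‖V_ℓ‖ ≤ C_V B_V^ℓ` for any
`C_V ≥ 2C_eC_R` and `B_V ≥ max{B_R, 2B_A, 4C_eC_AB_A}`; consequently for any
`0 ≤ ρ < 1` the series `Σ_ℓ δ^ℓ V_ℓ` converges whenever `B_V|δ| < ρ`. -/
theorem abstract_analyticity {Y Z : Type*}
    [NormedAddCommGroup Y] [NormedSpace ℝ Y] [CompleteSpace Y]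
    [NormedAddCommGroup Z] [NormedSpace ℝ Z]
    (R : ℕ → Z) (CR BR : ℝ) (hCR : 0 < CR) (hBR : 0 < BR)
    (hR : ∀ ℓ : ℕ, ‖R ℓ‖ ≤ CR * BR ^ ℓ)
    (A : ℕ → Y →L[ℝ] Z) (CA BA : ℝ) (hCA : 0 < CA) (hBA : 0 < BA)
    (hA : ∀ ℓ : ℕ, ‖A ℓ‖ ≤ CA * BA ^ ℓ)
    (Ainv : Z →L[ℝ] Y) (hleft : ∀ y : Y, Ainv (A 0 y) = y)
    (hright : ∀ z : Z, A 0 (Ainv z) = z)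
    (Ce : ℝ) (hCe : 0 < Ce) (hAinv : ‖Ainv‖ ≤ Ce)
    (V : ℕ → Y)
    (hV : ∀ ℓ : ℕ, V ℓ = Ainv (R ℓ - ∑ q ∈ Finset.range ℓ, A (ℓ - q) (V q))) :
    ∀ CV BV : ℝ, 2 * Ce * CR ≤ CV →
      max BR (max (2 * BA) (4 * Ce * CA * BA)) ≤ BV →
      (∀ ℓ : ℕ, ‖V ℓ‖ ≤ CV * BV ^ ℓ) ∧
      ∀ ρ : ℝ, 0 ≤ ρ → ρ < 1 → ∀ δ : ℝ, BV * |δ| < ρ →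
        Summable (fun ℓ : ℕ => δ ^ ℓ • V ℓ) := by
  intro CV BV hCV hBV
  obtain ⟨hBRV, hBAV, hBCV⟩ : BR ≤ BV ∧ 2 * BA ≤ BV ∧ 4 * Ce * CA * BA ≤ BV := by
    simpa only [max_le_iff] using hBV
  have hBVpos : 0 < BV := hBR.trans_le hBRV
  have hCVpos : 0 < CV := lt_of_lt_of_le (by positivity) hCV
  have hbound : ∀ ℓ : ℕ, ‖V ℓ‖ ≤ CV * BV ^ ℓ := by
    intro ℓ
    induction ℓ using Nat.strong_induction_on with
    | _ ℓ ih =>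
      set S := ∑ q ∈ Finset.range ℓ, BA ^ (ℓ - q) * BV ^ q with hS
      have hsum : ‖∑ q ∈ Finset.range ℓ, A (ℓ - q) (V q)‖ ≤ CA * CV * S := by
        rw [hS, Finset.mul_sum]
        refine norm_sum_le_of_le _ fun q hq => ?_
        calc ‖A (ℓ - q) (V q)‖ ≤ (CA * BA ^ (ℓ - q)) * (CV * BV ^ q) :=
              (A (ℓ - q)).le_of_opNorm_le_of_le (hA _) (ih q (Finset.mem_range.mp hq))
          _ = CA * CV * (BA ^ (ℓ - q) * BV ^ q) := by ring
      have hconv : Ce * CA * S ≤ BV ^ ℓ / 2 := by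
        refine le_of_mul_le_mul_left ?_ hBVpos
        calc BV * (Ce * CA * S) = Ce * CA * (BV * S) := by ring
          _ ≤ Ce * CA * (2 * BA * BV ^ ℓ) :=
              mul_le_mul_of_nonneg_left (mul_sum_range_pow_sub_mul_pow_le hBA.le hBAV ℓ)
                (by positivity)
          _ = 4 * Ce * CA * BA * (BV ^ ℓ / 2) := by ring
          _ ≤ BV * (BV ^ ℓ / 2) := by gcongr
      have hRV : ‖R ℓ‖ ≤ CR * BV ^ ℓ := (hR ℓ).trans (by gcongr)
      calc ‖V ℓ‖ = ‖Ainv (R ℓ - ∑ q ∈ Finset.range ℓ, A (ℓ - q) (V q))‖ := by rw [← hV ℓ]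
        _ ≤ Ce * (CR * BV ^ ℓ + CA * CV * S) :=
            Ainv.le_of_opNorm_le_of_le hAinv (norm_sub_le_of_le hRV hsum)
        _ = 2 * Ce * CR * (BV ^ ℓ / 2) + CV * (Ce * CA * S) := by ring
        _ ≤ CV * (BV ^ ℓ / 2) + CV * (BV ^ ℓ / 2) := by gcongr
        _ = CV * BV ^ ℓ := by ring
  refine ⟨hbound, fun ρ _ hρ δ hδ => ?_⟩
  refine Summable.of_norm_bounded (g := fun ℓ : ℕ => CV * (BV * |δ|) ^ ℓ)
    ((summable_geometric_of_lt_one (by positivity) (hδ.trans hρ)).mul_left CV) fun ℓ => ?_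
  calc ‖δ ^ ℓ • V ℓ‖ = |δ| ^ ℓ * ‖V ℓ‖ := by rw [norm_smul, norm_pow, Real.norm_eq_abs]
    _ ≤ |δ| ^ ℓ * (CV * BV ^ ℓ) := by gcongr; exact hbound ℓ
    _ = CV * (BV * |δ|) ^ ℓ := by ring
end

section
/- Let s ≥ 0 be real, k₀ > 0, X₀ ≠ 0 real, and suppose the nonresonance condition inf_{p∈ℤ} |Δ^TE_p| > 0 holds. Then for every Q ∈ H^{s+1} and R ∈ H^s there exists a unique pair (U, W) ∈ H^{s+1} × H^{s+2} whose Fourier coefficients solve, for each p ∈ ℤ, the 2×2 system Û_p − Ŵ_p = Q̂_p and −iγ_{u,p} Û_p + (−iγ_{w,p} − ik₀X₀(σ̂_loc + σ̂_nloc α_p²)) Ŵ_p = R̂_p; moreover there is a constant C_e > 0 independent of Q, R such that ‖U‖_{H^{s+1}} ≤ C_e(‖Q‖_{H^{s+1}} + ‖R‖_{H^s}) and ‖W‖_{H^{s+2}} ≤ C_e(‖Q‖_{H^{s+1}} + ‖R‖_{H^s}). -/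
open Real Complex

/-- The vertical wavenumber grows at most linearly. -/
lemma norm_gamC_le {k : ℝ} (hk : 0 ≤ k) (a : ℝ) : ‖gamC k a‖ ≤ k + |a| := by
  have ha := abs_nonneg a
  unfold gamC
  split_ifs
  · rw [Complex.norm_real, Real.norm_of_nonneg (Real.sqrt_nonneg _)]
    exact Real.sqrt_le_iff.2 ⟨by positivity, by nlinarith [sq_abs a]⟩
  · rw [norm_mul, Complex.norm_I, one_mul, Complex.norm_real,
      Real.norm_of_nonneg (Real.sqrt_nonneg _)]
    exact Real.sqrt_le_iff.2 ⟨by positivity, by nlinarith [sq_abs a]⟩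

/-- The square of the vertical wavenumber is dominated by `1 + |p| ^ 2`. -/
lemma exists_norm_gamC_sq_le {k : ℝ} (hk : 0 ≤ k) (α b : ℝ) :
    ∃ G : ℝ, 0 ≤ G ∧ ∀ p : ℤ, ‖gamC k (α + b * p)‖ ^ 2 ≤ G * (1 + |(p : ℝ)| ^ 2) := by
  refine ⟨(k + |α| + |b|) ^ 2 * 2, by positivity, fun p => ?_⟩
  have hab : |α + b * p| ≤ |α| + |b| * |(p : ℝ)| := by
    simpa [abs_mul] using abs_add_le α (b * p)
  have hle : ‖gamC k (α + b * p)‖ ≤ (k + |α| + |b|) * (1 + |(p : ℝ)|) := by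
    have h₁ : 0 ≤ (k + |α|) * |(p : ℝ)| := by positivity
    have h₂ := abs_nonneg b
    linarith [norm_gamC_le hk (α + b * p)]
  calc ‖gamC k (α + b * p)‖ ^ 2 ≤ ((k + |α| + |b|) * (1 + |(p : ℝ)|)) ^ 2 := by gcongr
    _ = (k + |α| + |b|) ^ 2 * (1 + |(p : ℝ)|) ^ 2 := by ring
    _ ≤ (k + |α| + |b|) ^ 2 * (2 * (1 + |(p : ℝ)| ^ 2)) := by
        gcongr
        nlinarith [sq_nonneg (1 - |(p : ℝ)|)]
    _ = _ := by ring

/-- A nonresonant determinant with nonzero nonlocal coefficient grows at least quadratically. -/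
lemma exists_le_mul_norm_DeltaTE {d α ku kw k₀ X₀ μ : ℝ} {σl σn : ℂ} (hd : 0 < d)
    (hku : 0 ≤ ku) (hkw : 0 ≤ kw) (hk₀ : k₀ ≠ 0) (hX₀ : X₀ ≠ 0) (hσn : σn ≠ 0) (hμ : 0 < μ)
    (hres : ∀ p : ℤ, μ ≤ ‖DeltaTE d α ku kw k₀ X₀ σl σn p‖) :
    ∃ K : ℝ, 0 ≤ K ∧ ∀ p : ℤ,
      1 + |(p : ℝ)| ^ 2 ≤ K * ‖DeltaTE d α ku kw k₀ X₀ σl σn p‖ := by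
  obtain ⟨κ, hκ⟩ : ∃ κ : ℝ, κ = |k₀| * ‖σn‖ * |X₀| := ⟨_, rfl⟩
  have hκ₀ : 0 < κ := by
    rw [hκ]
    have := norm_pos_iff.2 hσn
    positivity
  obtain ⟨M, hM⟩ : ∃ M : ℝ, M = ku + kw + |k₀| * ‖σl‖ * |X₀| := ⟨_, rfl⟩
  have hM₀ : 0 ≤ M := by rw [hM]; positivity
  obtain ⟨A, hA⟩ : ∃ A : ℝ, A = 2 / κ * (1 + (M + 2 / κ) / μ) := ⟨_, rfl⟩
  have hA₀ : 0 ≤ A := by rw [hA]; positivity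
  obtain ⟨t, ht⟩ : ∃ t : ℝ, t = d / (2 * π) := ⟨_, rfl⟩
  refine ⟨1 / μ + 2 * t ^ 2 * (A + α ^ 2 / μ), by positivity, fun p => ?_⟩
  obtain ⟨a, ha⟩ : ∃ a : ℝ, a = α + (2 * π / d) * p := ⟨_, rfl⟩
  have hp : (p : ℝ) = t * (a - α) := by
    rw [ha, ht]
    have := Real.pi_pos
    field_simp
    ring
  have hres' := hres p
  have hupper : κ * a ^ 2 ≤ ‖DeltaTE d α ku kw k₀ X₀ σl σn p‖ + M + 2 * |a| := by
    have heq : Complex.I * (k₀ : ℂ) * σn * (X₀ : ℂ) * ((a ^ 2 : ℝ) : ℂ)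
        = -DeltaTE d α ku kw k₀ X₀ σl σn p + -Complex.I * gamC ku a
          + -Complex.I * gamC kw a + -Complex.I * (k₀ : ℂ) * σl * (X₀ : ℂ) := by
      rw [DeltaTE, ← ha]
      ring
    have hn := congrArg norm heq
    have hl : ‖Complex.I * (k₀ : ℂ) * σn * (X₀ : ℂ) * ((a ^ 2 : ℝ) : ℂ)‖ = κ * a ^ 2 := by
      rw [hκ]
      simp only [norm_mul, Complex.norm_I, Complex.norm_real, Real.norm_eq_abs, abs_pow, sq_abs]
      ring
    have hu := norm_add₄_le (a := -DeltaTE d α ku kw k₀ X₀ σl σn p)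
      (b := -Complex.I * gamC ku a) (c := -Complex.I * gamC kw a)
      (d := -Complex.I * (k₀ : ℂ) * σl * (X₀ : ℂ))
    simp only [norm_mul, norm_neg, Complex.norm_I, Complex.norm_real, Real.norm_eq_abs,
      one_mul] at hu
    rw [hl] at hn
    linarith [norm_gamC_le hku a, norm_gamC_le hkw a]
  generalize ‖DeltaTE d α ku kw k₀ X₀ σl σn p‖ = D at hres' hupper ⊢
  have hone : 1 ≤ D / μ := (one_le_div hμ).2 hres'
  have habs : 2 * |a| ≤ κ / 2 * a ^ 2 + 2 / κ := by
    have : κ / 2 * a ^ 2 + 2 / κ - 2 * |a| = (κ * |a| - 2) ^ 2 / (2 * κ) := by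
      rw [← sq_abs a]
      field_simp
      ring
    have : 0 ≤ (κ * |a| - 2) ^ 2 / (2 * κ) := by positivity
    linarith
  have ha2 : a ^ 2 ≤ A * D := by
    have h₁ : M + 2 / κ ≤ (M + 2 / κ) * (D / μ) :=
      le_mul_of_one_le_right (by positivity) hone
    have h₂ : κ / 2 * a ^ 2 ≤ D + (M + 2 / κ) * (D / μ) := by linarith
    calc a ^ 2 = 2 / κ * (κ / 2 * a ^ 2) := by field_simp
      _ ≤ 2 / κ * (D + (M + 2 / κ) * (D / μ)) := by gcongr
      _ = A * D := by rw [hA]; ring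
  have hα : α ^ 2 ≤ α ^ 2 * (D / μ) := le_mul_of_one_le_right (by positivity) hone
  calc 1 + |(p : ℝ)| ^ 2 = 1 + t ^ 2 * (a - α) ^ 2 := by rw [sq_abs, hp]; ring
    _ ≤ 1 + t ^ 2 * (2 * (a ^ 2 + α ^ 2)) := by
        gcongr
        nlinarith [sq_nonneg (a + α)]
    _ ≤ D / μ + t ^ 2 * (2 * (A * D + α ^ 2 * (D / μ))) := by gcongr
    _ = _ := by ring

/-- The nonlocal conductivity coefficient does not vanish. -/
lemma sigma_nloc_ne_zero {c Γ h f vF τ : ℝ} (hc : c ≠ 0) (hΓ : Γ ≠ 0) (hf : f ≠ 0)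
    (hvF : vF ≠ 0) :
    ((c : ℝ) : ℂ) / ((Γ : ℂ) - Complex.I * (h : ℂ) * (f : ℂ)) *
      (((vF ^ 2 : ℝ) : ℂ) * ((3 * (f : ℂ) + 2 * Complex.I / (τ : ℂ)) /
        (4 * (f : ℂ) * ((f : ℂ) + Complex.I / (τ : ℂ)) ^ 2))) ≠ 0 := by
  have h₁ : (Γ : ℂ) - Complex.I * (h : ℂ) * (f : ℂ) ≠ 0 := fun h0 => hΓ <| by
    simpa using congrArg Complex.re h0
  have h₂ : 3 * (f : ℂ) + 2 * Complex.I / (τ : ℂ) ≠ 0 := fun h0 => hf <| by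
    simpa [Complex.div_ofReal_re] using congrArg Complex.re h0
  have h₃ : (f : ℂ) + Complex.I / (τ : ℂ) ≠ 0 := fun h0 => hf <| by
    simpa [Complex.div_ofReal_re] using congrArg Complex.re h0
  have h₄ : (f : ℂ) ≠ 0 := Complex.ofReal_ne_zero.2 hf
  have h₅ : (c : ℂ) ≠ 0 := Complex.ofReal_ne_zero.2 hc
  have h₆ : ((vF ^ 2 : ℝ) : ℂ) ≠ 0 := Complex.ofReal_ne_zero.2 (pow_ne_zero 2 hvF)
  exact mul_ne_zero (div_ne_zero h₅ h₁) (mul_ne_zero h₆ (div_ne_zero h₂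
    (mul_ne_zero (mul_ne_zero (by norm_num) h₄) (pow_ne_zero 2 h₃))))

/-- A termwise bound of nonnegative families gives summability and a bound between the
square roots of the sums. -/
lemma summable_and_sqrt_tsum_le {ι : Type*} {F G H : ι → ℝ} {C : ℝ} (hC : 0 ≤ C)
    (hF : ∀ i, 0 ≤ F i) (hG : ∀ i, 0 ≤ G i) (hH : ∀ i, 0 ≤ H i)
    (hGs : Summable G) (hHs : Summable H) (hle : ∀ i, F i ≤ C * (G i + H i)) :
    Summable F ∧ √(∑' i, F i) ≤ √C * (√(∑' i, G i) + √(∑' i, H i)) := by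
  have hs : Summable fun i => C * (G i + H i) := (hGs.add hHs).mul_left C
  have hFs : Summable F := hs.of_nonneg_of_le hF hle
  refine ⟨hFs, ?_⟩
  calc √(∑' i, F i) ≤ √(∑' i, C * (G i + H i)) := Real.sqrt_le_sqrt (hFs.tsum_le_tsum hle hs)
    _ = √C * √(∑' i, G i + ∑' i, H i) := by
        rw [tsum_mul_left, hGs.tsum_add hHs, Real.sqrt_mul hC]
    _ ≤ √C * (√(∑' i, G i) + √(∑' i, H i)) := by
        gcongr
        refine Real.sqrt_le_iff.2 ⟨by positivity, ?_⟩
        have h₁ : √(∑' i, G i) ^ 2 = ∑' i, G i := Real.sq_sqrt (tsum_nonneg hG)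
        have h₂ : √(∑' i, H i) ^ 2 = ∑' i, H i := Real.sq_sqrt (tsum_nonneg hH)
        have h₃ : 0 ≤ √(∑' i, G i) * √(∑' i, H i) := by positivity
        nlinarith

/-- Weighted estimates for a single mode: if `D * w = r + g * q` with `‖D‖` bounded below by a
multiple of the weight `B` and `‖g‖ ^ 2` bounded above by one, then `w` gains two orders over `r`
and one over `q`. -/
lemma weighted_mode_bounds {B s K G : ℝ} {D g q r w : ℂ} (hB : 1 ≤ B) (hK : 0 ≤ K) (hG : 0 ≤ G)
    (hD : B ≤ K * ‖D‖) (hg : ‖g‖ ^ 2 ≤ G * B) (hw : D * w = r + g * q) :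
    B ^ (s + 2) * ‖w‖ ^ 2 ≤
        2 * K ^ 2 * (1 + G) * (B ^ (s + 1) * ‖q‖ ^ 2 + B ^ s * ‖r‖ ^ 2) ∧
      B ^ (s + 1) * ‖q + w‖ ^ 2 ≤ (2 + 2 * (2 * K ^ 2 * (1 + G))) *
        (B ^ (s + 1) * ‖q‖ ^ 2 + B ^ s * ‖r‖ ^ 2) := by
  have hB₀ : 0 < B := by linarith
  have h₁ : B ^ (s + 1) = B ^ s * B := Real.rpow_add_one hB₀.ne' s
  have h₂ : B ^ (s + 2) = B ^ s * B ^ 2 := by exact_mod_cast Real.rpow_add_natCast hB₀.ne' s 2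
  rw [h₁, h₂]
  have hS : 0 < B ^ s := Real.rpow_pos_of_pos hB₀ s
  generalize B ^ s = S at hS
  have hBw : B * ‖w‖ ≤ K * (‖r‖ + ‖g‖ * ‖q‖) := by
    calc B * ‖w‖ ≤ K * ‖D‖ * ‖w‖ := by gcongr
      _ = K * ‖r + g * q‖ := by rw [mul_assoc, ← norm_mul, hw]
      _ ≤ K * (‖r‖ + ‖g‖ * ‖q‖) := by
          gcongr
          simpa using norm_add_le r (g * q)
  have hsq : B ^ 2 * ‖w‖ ^ 2 ≤ 2 * K ^ 2 * (1 + G) * (B * ‖q‖ ^ 2 + ‖r‖ ^ 2) := by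
    calc B ^ 2 * ‖w‖ ^ 2 = (B * ‖w‖) ^ 2 := by ring
      _ ≤ (K * (‖r‖ + ‖g‖ * ‖q‖)) ^ 2 := by gcongr
      _ = K ^ 2 * (‖r‖ + ‖g‖ * ‖q‖) ^ 2 := by ring
      _ ≤ K ^ 2 * (2 * (‖r‖ ^ 2 + ‖g‖ ^ 2 * ‖q‖ ^ 2)) := by
          gcongr
          nlinarith [sq_nonneg (‖r‖ - ‖g‖ * ‖q‖)]
      _ ≤ K ^ 2 * (2 * (‖r‖ ^ 2 + G * B * ‖q‖ ^ 2)) := by gcongr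
      _ ≤ K ^ 2 * (2 * (‖r‖ ^ 2 + G * B * ‖q‖ ^ 2 + (G * ‖r‖ ^ 2 + B * ‖q‖ ^ 2))) := by
          gcongr K ^ 2 * (2 * ?_)
          exact le_add_of_nonneg_right (by positivity)
      _ = _ := by ring
  have hwS : S * B ^ 2 * ‖w‖ ^ 2 ≤
      2 * K ^ 2 * (1 + G) * (S * B * ‖q‖ ^ 2 + S * ‖r‖ ^ 2) := by
    calc S * B ^ 2 * ‖w‖ ^ 2 = S * (B ^ 2 * ‖w‖ ^ 2) := by ring
      _ ≤ S * (2 * K ^ 2 * (1 + G) * (B * ‖q‖ ^ 2 + ‖r‖ ^ 2)) := by gcongr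
      _ = _ := by ring
  refine ⟨hwS, ?_⟩
  calc S * B * ‖q + w‖ ^ 2 ≤ S * B * (‖q‖ + ‖w‖) ^ 2 := by
        gcongr
        exact norm_add_le q w
    _ ≤ S * B * (2 * (‖q‖ ^ 2 + ‖w‖ ^ 2)) := by
        gcongr
        nlinarith [sq_nonneg (‖q‖ - ‖w‖)]
    _ = 2 * (S * B * ‖q‖ ^ 2) + 2 * (S * B ^ 1 * ‖w‖ ^ 2) := by ring
    _ ≤ 2 * (S * B * ‖q‖ ^ 2) + 2 * (S * B ^ 2 * ‖w‖ ^ 2) := by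
        gcongr
        exact one_le_two
    _ ≤ 2 * (S * B * ‖q‖ ^ 2 + S * ‖r‖ ^ 2)
        + 2 * (2 * K ^ 2 * (1 + G) * (S * B * ‖q‖ ^ 2 + S * ‖r‖ ^ 2)) := by
        gcongr
        exact le_add_of_nonneg_right (by positivity)
    _ = _ := by ring

/-- Lemma 4.4, TE linear solve: under nonresonance
(`inf_p |Δ^TE_p| > 0`) and `X₀ ≠ 0`, for data `Q ∈ H^{s+1}`, `R ∈ H^s` the
per-mode 2×2 TE system has a unique solution `(U,W)`, which lies in
`H^{s+1} × H^{s+2}` and obeys `‖U‖_{H^{s+1}}, ‖W‖_{H^{s+2}} ≤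
C_e(‖Q‖_{H^{s+1}} + ‖R‖_{H^s})`. -/
theorem te_linear_solve (d α ku kw k₀ X₀ s : ℝ)
    (hd : 0 < d) (hku : 0 < ku) (hkw : 0 < kw) (hk₀ : 0 < k₀)
    (hX₀ : X₀ ≠ 0) (hs : 0 ≤ s)
    (EF e ε₀ c₀ Γ h f vF τ : ℝ)
    (hEF : 0 < EF) (he : 0 < e) (hε₀ : 0 < ε₀) (hc₀ : 0 < c₀)
    (hΓ : 0 < Γ) (hh : 0 < h) (hf : 0 < f) (hvF : 0 < vF) (hτ : 0 < τ)
    (σl σn Q : ℂ)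
    (hσl : σl = ((2 * EF * e ^ 2 / (ε₀ * c₀) : ℝ) : ℂ) /
      ((Γ : ℂ) - Complex.I * (h : ℂ) * (f : ℂ)))
    (hQ : Q = ((vF ^ 2 : ℝ) : ℂ) *
      ((3 * (f : ℂ) + 2 * Complex.I / (τ : ℂ)) /
        (4 * (f : ℂ) * ((f : ℂ) + Complex.I / (τ : ℂ)) ^ 2)))
    (hσn : σn = σl * Q)
    (μ : ℝ) (hμ : 0 < μ)
    (hres : ∀ p : ℤ, μ ≤ ‖DeltaTE d α ku kw k₀ X₀ σl σn p‖) :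
    ∃ Ce : ℝ, 0 < Ce ∧ ∀ Qd Rd : ℤ → ℂ,
      Summable (fun p : ℤ => (1 + |(p : ℝ)| ^ 2) ^ (s + 1) * ‖Qd p‖ ^ 2) →
      Summable (fun p : ℤ => (1 + |(p : ℝ)| ^ 2) ^ s * ‖Rd p‖ ^ 2) →
      (∃! UW : (ℤ → ℂ) × (ℤ → ℂ), ∀ p : ℤ,
        UW.1 p - UW.2 p = Qd p ∧
        (-Complex.I * gamC ku (α + (2 * π / d) * p)) * UW.1 p
          + (-Complex.I * gamC kw (α + (2 * π / d) * p)
              - Complex.I * (k₀ : ℂ) * (X₀ : ℂ) *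
                (σl + σn * ((((α + (2 * π / d) * p) ^ 2 : ℝ)) : ℂ))) * UW.2 p = Rd p) ∧
      ∀ U W : ℤ → ℂ,
        (∀ p : ℤ,
          U p - W p = Qd p ∧
          (-Complex.I * gamC ku (α + (2 * π / d) * p)) * U p
            + (-Complex.I * gamC kw (α + (2 * π / d) * p)
                - Complex.I * (k₀ : ℂ) * (X₀ : ℂ) *
                  (σl + σn * ((((α + (2 * π / d) * p) ^ 2 : ℝ)) : ℂ))) * W p = Rd p) →
        Summable (fun p : ℤ => (1 + |(p : ℝ)| ^ 2) ^ (s + 1) * ‖U p‖ ^ 2) ∧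
        Summable (fun p : ℤ => (1 + |(p : ℝ)| ^ 2) ^ (s + 2) * ‖W p‖ ^ 2) ∧
        Real.sqrt (∑' p : ℤ, (1 + |(p : ℝ)| ^ 2) ^ (s + 1) * ‖U p‖ ^ 2)
          ≤ Ce * (Real.sqrt (∑' p : ℤ, (1 + |(p : ℝ)| ^ 2) ^ (s + 1) * ‖Qd p‖ ^ 2)
              + Real.sqrt (∑' p : ℤ, (1 + |(p : ℝ)| ^ 2) ^ s * ‖Rd p‖ ^ 2)) ∧
        Real.sqrt (∑' p : ℤ, (1 + |(p : ℝ)| ^ 2) ^ (s + 2) * ‖W p‖ ^ 2)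
          ≤ Ce * (Real.sqrt (∑' p : ℤ, (1 + |(p : ℝ)| ^ 2) ^ (s + 1) * ‖Qd p‖ ^ 2)
              + Real.sqrt (∑' p : ℤ, (1 + |(p : ℝ)| ^ 2) ^ s * ‖Rd p‖ ^ 2)) := by
  have hσn₀ : σn ≠ 0 := by
    rw [hσn, hσl, hQ]
    exact sigma_nloc_ne_zero (by positivity) hΓ.ne' hf.ne' hvF.ne'
  obtain ⟨K, hK, hDelta⟩ :=
    exists_le_mul_norm_DeltaTE hd hku.le hkw.le hk₀.ne' hX₀ hσn₀ hμ hres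
  obtain ⟨G, hG, hgam⟩ := exists_norm_gamC_sq_le hku.le α (2 * π / d)
  have hΔ₀ : ∀ p, DeltaTE d α ku kw k₀ X₀ σl σn p ≠ 0 := fun p =>
    norm_pos_iff.1 (hμ.trans_le (hres p))
  -- Eliminating `u` turns the two equations of a mode into a scalar equation for `w`.
  have hsys : ∀ (p : ℤ) (q r u w : ℂ),
      (u - w = q ∧
        (-Complex.I * gamC ku (α + (2 * π / d) * p)) * u
          + (-Complex.I * gamC kw (α + (2 * π / d) * p)
              - Complex.I * (k₀ : ℂ) * (X₀ : ℂ) *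
                (σl + σn * ((((α + (2 * π / d) * p) ^ 2 : ℝ)) : ℂ))) * w = r) ↔
      (u = q + w ∧ DeltaTE d α ku kw k₀ X₀ σl σn p * w
        = r + Complex.I * gamC ku (α + (2 * π / d) * p) * q) := by
    intro p q r u w
    rw [sub_eq_iff_eq_add, DeltaTE]
    refine and_congr_right fun hu => ?_
    subst hu
    constructor <;> intro heq <;> linear_combination heq
  simp only [hsys]
  refine ⟨√(2 + 2 * (2 * K ^ 2 * (1 + G))), by positivity, fun Qd Rd hQd hRd => ⟨?_, ?_⟩⟩
  · refine ⟨(fun p => Qd p + (Rd p + Complex.I * gamC ku (α + (2 * π / d) * p) * Qd p)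
        / DeltaTE d α ku kw k₀ X₀ σl σn p,
      fun p => (Rd p + Complex.I * gamC ku (α + (2 * π / d) * p) * Qd p)
        / DeltaTE d α ku kw k₀ X₀ σl σn p), fun p => ⟨rfl, mul_div_cancel₀ _ (hΔ₀ p)⟩, ?_⟩
    rintro ⟨U, W⟩ hUW
    have hW : ∀ p, W p = (Rd p + Complex.I * gamC ku (α + (2 * π / d) * p) * Qd p)
        / DeltaTE d α ku kw k₀ X₀ σl σn p := fun p =>
      eq_div_of_mul_eq (hΔ₀ p) (by rw [mul_comm]; exact (hUW p).2)
    refine Prod.ext (funext fun p => ?_) (funext hW)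
    exact (hUW p).1.trans (congrArg (Qd p + ·) (hW p))
  · intro U W hUW
    have hmode := fun p : ℤ => weighted_mode_bounds (s := s) (B := 1 + |(p : ℝ)| ^ 2)
      (le_add_of_nonneg_right (by positivity)) hK hG (hDelta p)
      (by simpa using hgam p) (hUW p).2
    have hU := summable_and_sqrt_tsum_le (C := 2 + 2 * (2 * K ^ 2 * (1 + G)))
      (F := fun p : ℤ => (1 + |(p : ℝ)| ^ 2) ^ (s + 1) * ‖U p‖ ^ 2) (by positivity)
      (fun p => by positivity) (fun p => by positivity) (fun p => by positivity) hQd hRd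
      (fun p => by rw [(hUW p).1]; exact (hmode p).2)
    have hW := summable_and_sqrt_tsum_le (C := 2 + 2 * (2 * K ^ 2 * (1 + G)))
      (F := fun p : ℤ => (1 + |(p : ℝ)| ^ 2) ^ (s + 2) * ‖W p‖ ^ 2) (by positivity)
      (fun p => by positivity) (fun p => by positivity) (fun p => by positivity) hQd hRd
      (fun p => (hmode p).1.trans (by
        gcongr
        have : 0 ≤ 2 * K ^ 2 * (1 + G) := by positivity
        linarith))
    exact ⟨hU.1, hW.1, hU.2, hW.2⟩
end

section
/- Let s ≥ 0 be real, k₀ > 0, τ_u, τ_w > 0, X₀ ≠ 0 real, and suppose the nonresonance condition inf_{p∈ℤ} |Δ^TM_p| > 0 holds. Then for every Q ∈ H^s and R ∈ H^s there exists a unique pair (U, W) ∈ H^{s+1} × H^{s+3} whose Fourier coefficients solve, for each p ∈ ℤ, the 2×2 system Û_p + (−1 − (X₀/(ik₀))(σ̂_loc + σ̂_nloc α_p²) τ_w iγ_{w,p}) Ŵ_p = Q̂_p and −τ_u iγ_{u,p} Û_p − τ_w iγ_{w,p} Ŵ_p = R̂_p; moreover there is a constant C_e > 0 independent of Q, R such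 that ‖U‖_{H^{s+1}} ≤ C_e(‖Q‖_{H^s} + ‖R‖_{H^s}) and ‖W‖_{H^{s+3}} ≤ C_e(‖Q‖_{H^s} + ‖R‖_{H^s}). -/
open Real Complex

lemma norm_gamC_sq (k a : ℝ) : ‖gamC k a‖ ^ 2 = |k ^ 2 - a ^ 2| := by
  unfold gamC
  split_ifs with h
  · rw [Complex.norm_real, Real.norm_eq_abs, sq_abs, Real.sq_sqrt (by linarith),
      abs_of_nonneg (by linarith)]
  · rw [norm_mul, Complex.norm_I, one_mul, Complex.norm_real, Real.norm_eq_abs, sq_abs,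
      Real.sq_sqrt (by linarith), abs_of_neg (by linarith)]
    ring

lemma norm_gamC_le_of_le {k a : ℝ} (hk : 0 < k) (h : 2 * k ≤ |a|) : ‖gamC k a‖ ≤ 2 * |a| := by
  refine abs_le_of_sq_le_sq' ?_ (by positivity) |>.2
  rw [norm_gamC_sq, abs_le]
  constructor <;> nlinarith [sq_abs a]

lemma le_norm_gamC_of_le {k a : ℝ} (hk : 0 < k) (h : 2 * k ≤ |a|) : |a| / 2 ≤ ‖gamC k a‖ := by
  refine abs_le_of_sq_le_sq' ?_ (norm_nonneg _) |>.2
  rw [norm_gamC_sq, le_abs]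
  right
  nlinarith [sq_abs a]

lemma norm_gamC_le_mul_sqrt {k a M y : ℝ} (h : a ^ 2 ≤ M * y) (hM : 0 ≤ M) (hy : 1 ≤ y) :
    ‖gamC k a‖ ≤ √(k ^ 2 + M) * √y := by
  rw [← Real.sqrt_mul (by positivity)]
  refine Real.le_sqrt_of_sq_le ?_
  rw [norm_gamC_sq, abs_le]
  constructor <;> nlinarith [sq_nonneg k, sq_nonneg a]

lemma affine_sq_le (α b p : ℝ) : (α + b * p) ^ 2 ≤ 2 * (α ^ 2 + b ^ 2) * (1 + p ^ 2) := by
  nlinarith [sq_nonneg (α - b * p), sq_nonneg (α * p), sq_nonneg b]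

lemma one_add_sq_le_affine (α p : ℝ) {b : ℝ} (hb : b ≠ 0) :
    1 + p ^ 2 ≤ (1 + (2 + 2 * α ^ 2) / b ^ 2) * (1 + (α + b * p) ^ 2) := by
  have hb2 : 0 < b ^ 2 := by positivity
  have h : p ^ 2 ≤ (2 + 2 * α ^ 2) / b ^ 2 * (1 + (α + b * p) ^ 2) := by
    rw [div_mul_eq_mul_div, le_div_iff₀ hb2]
    nlinarith [sq_nonneg (α + (α + b * p)), sq_nonneg (α * (α + b * p))]
  nlinarith [sq_nonneg (α + b * p)]

/-- The determinant with the conductivity terms collected. -/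
lemma DeltaTM_eq (d α ku kw k₀ X₀ τu τw : ℝ) (σl σn : ℂ) (p : ℤ) :
    DeltaTM d α ku kw k₀ X₀ τu τw σl σn p =
      (τu : ℂ) * (τw : ℂ) * ((X₀ : ℂ) / (Complex.I * (k₀ : ℂ))) *
        (gamC ku (α + (2 * π / d) * p) * gamC kw (α + (2 * π / d) * p)) *
        (σl + σn * ((((α + (2 * π / d) * p) ^ 2 : ℝ)) : ℂ))
      - (Complex.I * ((τu : ℂ) * gamC ku (α + (2 * π / d) * p))
        + Complex.I * ((τw : ℂ) * gamC kw (α + (2 * π / d) * p))) := by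
  unfold DeltaTM
  ring

/-- Away from finitely many modes the collected determinant grows like the fourth power. -/
lemma eventually_le_norm_det {ku kw τu τw : ℝ} {κ σl σn : ℂ} (hku : 0 < ku) (hkw : 0 < kw)
    (hτu : 0 < τu) (hτw : 0 < τw) (hκ : κ ≠ 0) (hσn : σn ≠ 0) :
    ∃ c : ℝ, 0 < c ∧ ∃ T : ℝ, ∀ a : ℝ, T ≤ |a| → c * (1 + a ^ 2) ^ 2 ≤
      ‖(τu : ℂ) * (τw : ℂ) * κ * (gamC ku a * gamC kw a) * (σl + σn * ((a ^ 2 : ℝ) : ℂ))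
        - (Complex.I * ((τu : ℂ) * gamC ku a) + Complex.I * ((τw : ℂ) * gamC kw a))‖ := by
  set m := τu * τw * ‖κ‖ * ‖σn‖ with hm
  have hκ' : 0 < ‖κ‖ := norm_pos_iff.2 hκ
  have hσn' : 0 < ‖σn‖ := norm_pos_iff.2 hσn
  have hmpos : 0 < m := by positivity
  refine ⟨m / 64, by positivity,
    1 + 2 * ku + 2 * kw + 2 * ‖σl‖ / ‖σn‖ + 32 * (τu + τw) / m, fun a ha => ?_⟩
  have hq : 0 ≤ 2 * ‖σl‖ / ‖σn‖ := by positivity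
  have hr : 0 ≤ 32 * (τu + τw) / m := by positivity
  have h1 : 1 ≤ |a| := by linarith
  have hu : 2 * ku ≤ |a| := by linarith
  have hw : 2 * kw ≤ |a| := by linarith
  have hl : 2 * ‖σl‖ / ‖σn‖ ≤ |a| := by linarith
  have ht : 32 * (τu + τw) / m ≤ |a| := by linarith
  rw [div_le_iff₀ hσn'] at hl
  rw [div_le_iff₀ hmpos] at ht
  have hS : ‖σn‖ * |a| ^ 2 / 2 ≤ ‖σl + σn * ((a ^ 2 : ℝ) : ℂ)‖ := by
    have h2 := norm_sub_le (σl + σn * ((a ^ 2 : ℝ) : ℂ)) σl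
    rw [add_sub_cancel_left, norm_mul, Complex.norm_real, Real.norm_eq_abs, abs_pow] at h2
    have h3 : 2 * ‖σl‖ ≤ ‖σn‖ * |a| ^ 2 := by
      nlinarith [mul_le_mul_of_nonneg_left h1 (mul_nonneg (abs_nonneg a) hσn'.le)]
    linarith
  have hγu := le_norm_gamC_of_le hku hu
  have hγw := le_norm_gamC_of_le hkw hw
  have hγu' := norm_gamC_le_of_le hku hu
  have hγw' := norm_gamC_le_of_le hkw hw
  have hmain : m * |a| ^ 4 / 8 ≤ ‖(τu : ℂ) * (τw : ℂ) * κ * (gamC ku a * gamC kw a) *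
      (σl + σn * ((a ^ 2 : ℝ) : ℂ))‖ := by
    simp only [norm_mul, Complex.norm_real, Real.norm_eq_abs, abs_of_pos hτu, abs_of_pos hτw]
    calc m * |a| ^ 4 / 8
        = τu * τw * ‖κ‖ * (|a| / 2 * (|a| / 2)) * (‖σn‖ * |a| ^ 2 / 2) := by rw [hm]; ring
      _ ≤ _ := by
        gcongr
  have hlow : ‖Complex.I * ((τu : ℂ) * gamC ku a) + Complex.I * ((τw : ℂ) * gamC kw a)‖
      ≤ 2 * (τu + τw) * |a| := by
    refine (norm_add_le _ _).trans ?_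
    simp only [norm_mul, Complex.norm_real, Complex.norm_I, Real.norm_eq_abs, abs_of_pos hτu,
      abs_of_pos hτw]
    nlinarith
  have hfin : 2 * (τu + τw) * |a| ≤ m * |a| ^ 4 / 16 := by
    have h3 : |a| ^ 2 ≤ |a| ^ 4 := pow_le_pow_right₀ h1 (by norm_num)
    nlinarith
  have hw4 : (1 + a ^ 2) ^ 2 ≤ 4 * |a| ^ 4 := by
    rw [← sq_abs a]
    have h3 : 1 ≤ |a| ^ 2 := one_le_pow₀ h1
    nlinarith
  have hsub := norm_sub_norm_le ((τu : ℂ) * (τw : ℂ) * κ * (gamC ku a * gamC kw a) *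
    (σl + σn * ((a ^ 2 : ℝ) : ℂ)))
    (Complex.I * ((τu : ℂ) * gamC ku a) + Complex.I * ((τw : ℂ) * gamC kw a))
  nlinarith

/-- Under nonresonance the determinant is bounded below by a multiple of `⟨p⟩ ^ 4`. -/
lemma exists_mul_le_norm_DeltaTM {d α ku kw k₀ X₀ τu τw μ : ℝ} {σl σn : ℂ}
    (hd : 0 < d) (hku : 0 < ku) (hkw : 0 < kw) (hk₀ : 0 < k₀) (hτu : 0 < τu) (hτw : 0 < τw)
    (hX₀ : X₀ ≠ 0) (hσn : σn ≠ 0) (hμ : 0 < μ)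
    (hres : ∀ p : ℤ, μ ≤ ‖DeltaTM d α ku kw k₀ X₀ τu τw σl σn p‖) :
    ∃ c : ℝ, 0 < c ∧ ∀ p : ℤ,
      c * (1 + (p : ℝ) ^ 2) ^ 2 ≤ ‖DeltaTM d α ku kw k₀ X₀ τu τw σl σn p‖ := by
  have hκ : (X₀ : ℂ) / (Complex.I * (k₀ : ℂ)) ≠ 0 :=
    div_ne_zero (Complex.ofReal_ne_zero.2 hX₀)
      (mul_ne_zero Complex.I_ne_zero (Complex.ofReal_ne_zero.2 hk₀.ne'))
  obtain ⟨c, hc, T, hT⟩ :=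
    eventually_le_norm_det (σl := σl) hku hkw hτu hτw hκ hσn
  have hb : 2 * π / d ≠ 0 := by positivity
  set K := 1 + (2 + 2 * α ^ 2) / (2 * π / d) ^ 2 with hK
  have hKpos : 0 < K := by positivity
  refine ⟨min c (μ / (1 + T ^ 2) ^ 2) / K ^ 2, by positivity, fun p => ?_⟩
  have hp := one_add_sq_le_affine α (p : ℝ) hb
  rw [← hK] at hp
  have hres := hres p
  rw [DeltaTM_eq] at hres ⊢
  generalize α + 2 * π / d * (p : ℝ) = a at hp hres ⊢
  calc min c (μ / (1 + T ^ 2) ^ 2) / K ^ 2 * (1 + (p : ℝ) ^ 2) ^ 2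
      ≤ min c (μ / (1 + T ^ 2) ^ 2) / K ^ 2 * (K * (1 + a ^ 2)) ^ 2 := by gcongr
    _ = min c (μ / (1 + T ^ 2) ^ 2) * (1 + a ^ 2) ^ 2 := by field_simp
    _ ≤ _ := by
      rcases le_total T |a| with h | h
      · exact (mul_le_mul_of_nonneg_right (min_le_left _ _) (by positivity)).trans (hT a h)
      · have ha : a ^ 2 ≤ T ^ 2 := by
          rw [← sq_abs a]
          gcongr
        calc min c (μ / (1 + T ^ 2) ^ 2) * (1 + a ^ 2) ^ 2
            ≤ μ / (1 + T ^ 2) ^ 2 * (1 + T ^ 2) ^ 2 := by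
              gcongr
              exact min_le_right _ _
          _ = μ := by field_simp
          _ ≤ _ := hres

/-- A pointwise gain of `m` powers of `1 + |p| ^ 2` gives the corresponding Sobolev estimate. -/
lemma sobolev_estimate {s m C : ℝ} (hC : 0 ≤ C) {q r v : ℤ → ℂ}
    (hq : Summable (fun p : ℤ => (1 + |(p : ℝ)| ^ 2) ^ s * ‖q p‖ ^ 2))
    (hr : Summable (fun p : ℤ => (1 + |(p : ℝ)| ^ 2) ^ s * ‖r p‖ ^ 2))
    (hv : ∀ p : ℤ, (1 + |(p : ℝ)| ^ 2) ^ m * ‖v p‖ ^ 2 ≤ C ^ 2 * (‖q p‖ ^ 2 + ‖r p‖ ^ 2)) :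
    Summable (fun p : ℤ => (1 + |(p : ℝ)| ^ 2) ^ (s + m) * ‖v p‖ ^ 2) ∧
    √(∑' p : ℤ, (1 + |(p : ℝ)| ^ 2) ^ (s + m) * ‖v p‖ ^ 2) ≤
      C * (√(∑' p : ℤ, (1 + |(p : ℝ)| ^ 2) ^ s * ‖q p‖ ^ 2) +
        √(∑' p : ℤ, (1 + |(p : ℝ)| ^ 2) ^ s * ‖r p‖ ^ 2)) := by
  have hle : ∀ p : ℤ, (1 + |(p : ℝ)| ^ 2) ^ (s + m) * ‖v p‖ ^ 2 ≤
      C ^ 2 * ((1 + |(p : ℝ)| ^ 2) ^ s * ‖q p‖ ^ 2 + (1 + |(p : ℝ)| ^ 2) ^ s * ‖r p‖ ^ 2) := by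
    intro p
    rw [Real.rpow_add (by positivity), mul_assoc]
    calc _ ≤ (1 + |(p : ℝ)| ^ 2) ^ s * (C ^ 2 * (‖q p‖ ^ 2 + ‖r p‖ ^ 2)) := by
          exact mul_le_mul_of_nonneg_left (hv p) (by positivity)
      _ = _ := by ring
  have hsum := (hq.add hr).mul_left (C ^ 2)
  have hvs : Summable (fun p : ℤ => (1 + |(p : ℝ)| ^ 2) ^ (s + m) * ‖v p‖ ^ 2) :=
    Summable.of_nonneg_of_le (fun p => by positivity) hle hsum
  refine ⟨hvs, ?_⟩
  have h := hvs.tsum_le_tsum hle hsum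
  rw [tsum_mul_left, hq.tsum_add hr] at h
  have hq0 : 0 ≤ ∑' p : ℤ, (1 + |(p : ℝ)| ^ 2) ^ s * ‖q p‖ ^ 2 :=
    tsum_nonneg fun p => by positivity
  have hr0 : 0 ≤ ∑' p : ℤ, (1 + |(p : ℝ)| ^ 2) ^ s * ‖r p‖ ^ 2 :=
    tsum_nonneg fun p => by positivity
  refine (Real.sqrt_le_sqrt h).trans ?_
  rw [Real.sqrt_mul (sq_nonneg C), Real.sqrt_sq hC]
  gcongr
  refine Real.sqrt_le_iff.2 ⟨by positivity, ?_⟩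
  nlinarith [Real.sq_sqrt hq0, Real.sq_sqrt hr0, mul_nonneg (Real.sqrt_nonneg _)
    (Real.sqrt_nonneg _) (a := √(∑' p : ℤ, (1 + |(p : ℝ)| ^ 2) ^ s * ‖q p‖ ^ 2))
    (b := √(∑' p : ℤ, (1 + |(p : ℝ)| ^ 2) ^ s * ‖r p‖ ^ 2))]

/-- Cramer's rule for the system `u + A w = q`, `B u + D w = r`. -/
lemma two_by_two_solution_iff {A B D u w q r : ℂ} (hdet : D - B * A ≠ 0) :
    (u + A * w = q ∧ B * u + D * w = r) ↔
      u = (D * q - A * r) / (D - B * A) ∧ w = (r - B * q) / (D - B * A) := by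
  rw [eq_div_iff hdet, eq_div_iff hdet]
  constructor
  · rintro ⟨rfl, rfl⟩
    constructor <;> ring
  · rintro ⟨h1, h2⟩
    constructor <;> refine mul_right_cancel₀ hdet ?_
    · linear_combination h1 + A * h2
    · linear_combination B * h1 + D * h2

/-- A quotient whose numerator grows at most like `y ^ j` and whose denominator grows at least
like `y ^ (j + n)` decays like `y ^ (-n)`, in squared form. -/
lemma sq_mul_norm_div_sq_le {y c M : ℝ} {n j : ℕ} {x a b Δ q r : ℂ} (hy : 0 < y)
    (hc : 0 < c) (hx : x = (a * q + b * r) / Δ) (ha : ‖a‖ ≤ M * y ^ j) (hb : ‖b‖ ≤ M * y ^ j)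
    (hΔ : c * y ^ (j + n) ≤ ‖Δ‖) (hM : 0 ≤ M) :
    (y ^ n) ^ 2 * ‖x‖ ^ 2 ≤ (2 * M / c) ^ 2 * (‖q‖ ^ 2 + ‖r‖ ^ 2) := by
  have hΔ0 : 0 < ‖Δ‖ := lt_of_lt_of_le (by positivity) hΔ
  have h1 : y ^ n * ‖x‖ ≤ M / c * (‖q‖ + ‖r‖) := by
    rw [hx, norm_div, ← mul_div_assoc, div_le_iff₀ hΔ0]
    calc y ^ n * ‖a * q + b * r‖ ≤ y ^ n * (M * y ^ j * ‖q‖ + M * y ^ j * ‖r‖) := by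
          gcongr
          refine (norm_add_le _ _).trans ?_
          rw [norm_mul, norm_mul]
          gcongr
      _ = M / c * (‖q‖ + ‖r‖) * (c * y ^ (j + n)) := by
          rw [pow_add]
          field_simp
      _ ≤ _ := by gcongr
  calc (y ^ n) ^ 2 * ‖x‖ ^ 2 = (y ^ n * ‖x‖) ^ 2 := by ring
    _ ≤ (M / c * (‖q‖ + ‖r‖)) ^ 2 := by gcongr
    _ = (M / c) ^ 2 * (‖q‖ + ‖r‖) ^ 2 := by ring
    _ ≤ (M / c) ^ 2 * (4 * (‖q‖ ^ 2 + ‖r‖ ^ 2)) := by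
        gcongr
        nlinarith [sq_nonneg (‖q‖ - ‖r‖), sq_nonneg ‖q‖, sq_nonneg ‖r‖]
    _ = _ := by ring

lemma drude_local_ne_zero {EF e ε₀ c₀ Γ h f : ℝ} (hEF : 0 < EF) (he : 0 < e) (hε₀ : 0 < ε₀)
    (hc₀ : 0 < c₀) (hΓ : 0 < Γ) :
    ((2 * EF * e ^ 2 / (ε₀ * c₀) : ℝ) : ℂ) / ((Γ : ℂ) - Complex.I * (h : ℂ) * (f : ℂ)) ≠ 0 := by
  refine div_ne_zero (Complex.ofReal_ne_zero.2 (by positivity)) fun h0 => ?_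
  have := congrArg Complex.re h0
  simp at this
  exact hΓ.ne' this

lemma nonlocal_factor_ne_zero {f vF τ : ℝ} (hf : 0 < f) (hvF : 0 < vF) :
    ((vF ^ 2 : ℝ) : ℂ) * ((3 * (f : ℂ) + 2 * Complex.I / (τ : ℂ)) /
        (4 * (f : ℂ) * ((f : ℂ) + Complex.I / (τ : ℂ)) ^ 2)) ≠ 0 := by
  refine mul_ne_zero (Complex.ofReal_ne_zero.2 (by positivity)) (div_ne_zero (fun h0 => ?_)
    (mul_ne_zero (mul_ne_zero (by norm_num) (Complex.ofReal_ne_zero.2 hf.ne'))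
      (pow_ne_zero 2 fun h0 => ?_)))
  · have := congrArg Complex.re h0
    simp [Complex.div_ofReal_re] at this
    exact hf.ne' this
  · have := congrArg Complex.re h0
    simp [Complex.div_ofReal_re] at this
    exact hf.ne' this

/-- Growth of the entries of the per-mode matrix. -/
lemma exists_coefficient_bounds (d α ku kw : ℝ) (κ σl σn : ℂ) {τu τw : ℝ} (hτu : 0 ≤ τu)
    (hτw : 0 ≤ τw) :
    ∃ L : ℝ, 1 ≤ L ∧ ∀ p : ℤ,
      ‖-1 - κ * (σl + σn * ((((α + (2 * π / d) * p) ^ 2 : ℝ)) : ℂ)) * (τw : ℂ) *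
        (Complex.I * gamC kw (α + (2 * π / d) * p))‖ ≤ L * √(1 + (p : ℝ) ^ 2) ^ 3 ∧
      ‖-(τu : ℂ) * Complex.I * gamC ku (α + (2 * π / d) * p)‖ ≤ L * √(1 + (p : ℝ) ^ 2) ∧
      ‖-((τw : ℂ) * Complex.I * gamC kw (α + (2 * π / d) * p))‖ ≤ L * √(1 + (p : ℝ) ^ 2) := by
  set M := 2 * (α ^ 2 + (2 * π / d) ^ 2) with hMdef
  set Gu := √(ku ^ 2 + M)
  set Gw := √(kw ^ 2 + M)
  set S := ‖σl‖ + ‖σn‖ * M with hS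
  have hM0 : 0 ≤ M := by positivity
  have hS0 : 0 ≤ S := by positivity
  set L := 1 + ‖κ‖ * S * τw * Gw + τw * Gw + τu * Gu with hL
  have hGu : 0 ≤ Gu := Real.sqrt_nonneg _
  have hGw : 0 ≤ Gw := Real.sqrt_nonneg _
  have hL1 : 1 ≤ L := by
    have : 0 ≤ ‖κ‖ * S * τw * Gw + τw * Gw + τu * Gu := by positivity
    linarith
  refine ⟨L, hL1, fun p => ?_⟩
  have ha := affine_sq_le α (2 * π / d) p
  have hy : 1 ≤ 1 + (p : ℝ) ^ 2 := by nlinarith [sq_nonneg (p : ℝ)]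
  have hgu := norm_gamC_le_mul_sqrt (k := ku) ha hM0 hy
  have hgw := norm_gamC_le_mul_sqrt (k := kw) ha hM0 hy
  have hy2 : √(1 + (p : ℝ) ^ 2) ^ 2 = 1 + (p : ℝ) ^ 2 := Real.sq_sqrt (by positivity)
  have hy1 : 1 ≤ √(1 + (p : ℝ) ^ 2) := Real.one_le_sqrt.2 hy
  generalize α + 2 * π / d * (p : ℝ) = a at ha hgu hgw ⊢
  rw [← hy2] at ha
  generalize √(1 + (p : ℝ) ^ 2) = y at *
  have hSb : ‖σl + σn * ((a ^ 2 : ℝ) : ℂ)‖ ≤ S * y ^ 2 := by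
    refine (norm_add_le _ _).trans ?_
    rw [norm_mul, Complex.norm_real, Real.norm_of_nonneg (sq_nonneg a)]
    have h1 : ‖σl‖ * 1 ≤ ‖σl‖ * y ^ 2 := by
      gcongr
      exact one_le_pow₀ hy1
    have h2 : ‖σn‖ * a ^ 2 ≤ ‖σn‖ * (M * y ^ 2) := by gcongr
    rw [hS]
    linarith
  refine ⟨?_, ?_, ?_⟩
  · refine (norm_sub_le _ _).trans ?_
    simp only [norm_neg, norm_one, norm_mul, Complex.norm_I, one_mul, Complex.norm_real,
      Real.norm_of_nonneg hτw]
    have h1 : ‖κ‖ * ‖σl + σn * ((a ^ 2 : ℝ) : ℂ)‖ * τw * ‖gamC kw a‖ ≤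
        ‖κ‖ * (S * y ^ 2) * τw * (Gw * y) := by gcongr
    have h2 : 1 ≤ y ^ 3 := one_le_pow₀ hy1
    have h3 : 0 ≤ (τw * Gw + τu * Gu) * y ^ 3 := by positivity
    rw [hL]
    linarith
  · simp only [norm_neg, norm_mul, Complex.norm_I, mul_one, Complex.norm_real,
      Real.norm_of_nonneg hτu]
    have h1 : τu * ‖gamC ku a‖ ≤ τu * (Gu * y) := by gcongr
    have h3 : 0 ≤ (1 + ‖κ‖ * S * τw * Gw + τw * Gw) * y := by positivity
    rw [hL]
    linarith
  · simp only [norm_neg, norm_mul, Complex.norm_I, mul_one, Complex.norm_real,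
      Real.norm_of_nonneg hτw]
    have h1 : τw * ‖gamC kw a‖ ≤ τw * (Gw * y) := by gcongr
    have h3 : 0 ≤ (1 + ‖κ‖ * S * τw * Gw + τu * Gu) * y := by positivity
    rw [hL]
    linarith

/-- Lemma 4.7, TM linear solve: under nonresonance
(`inf_p |Δ^TM_p| > 0`) and `X₀ ≠ 0`, for data `Q, R ∈ H^s` the per-mode 2×2 TM
system has a unique solution `(U,W)`, which lies in `H^{s+1} × H^{s+3}` and obeys
`‖U‖_{H^{s+1}}, ‖W‖_{H^{s+3}} ≤ C_e(‖Q‖_{H^s} + ‖R‖_{H^s})`. -/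
theorem tm_linear_solve (d α ku kw k₀ X₀ τu τw s : ℝ)
    (hd : 0 < d) (hku : 0 < ku) (hkw : 0 < kw) (hk₀ : 0 < k₀)
    (hτu : 0 < τu) (hτw : 0 < τw) (hX₀ : X₀ ≠ 0) (hs : 0 ≤ s)
    (EF e ε₀ c₀ Γ h f vF τ : ℝ)
    (hEF : 0 < EF) (he : 0 < e) (hε₀ : 0 < ε₀) (hc₀ : 0 < c₀)
    (hΓ : 0 < Γ) (hh : 0 < h) (hf : 0 < f) (hvF : 0 < vF) (hτ : 0 < τ)
    (σl σn Q : ℂ)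
    (hσl : σl = ((2 * EF * e ^ 2 / (ε₀ * c₀) : ℝ) : ℂ) /
      ((Γ : ℂ) - Complex.I * (h : ℂ) * (f : ℂ)))
    (hQ : Q = ((vF ^ 2 : ℝ) : ℂ) *
      ((3 * (f : ℂ) + 2 * Complex.I / (τ : ℂ)) /
        (4 * (f : ℂ) * ((f : ℂ) + Complex.I / (τ : ℂ)) ^ 2)))
    (hσn : σn = σl * Q)
    (μ : ℝ) (hμ : 0 < μ)
    (hres : ∀ p : ℤ, μ ≤ ‖DeltaTM d α ku kw k₀ X₀ τu τw σl σn p‖) :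
    ∃ Ce : ℝ, 0 < Ce ∧ ∀ Qd Rd : ℤ → ℂ,
      Summable (fun p : ℤ => (1 + |(p : ℝ)| ^ 2) ^ s * ‖Qd p‖ ^ 2) →
      Summable (fun p : ℤ => (1 + |(p : ℝ)| ^ 2) ^ s * ‖Rd p‖ ^ 2) →
      (∃! UW : (ℤ → ℂ) × (ℤ → ℂ), ∀ p : ℤ,
        UW.1 p + (-1 - ((X₀ : ℂ) / (Complex.I * (k₀ : ℂ))) *
            (σl + σn * ((((α + (2 * π / d) * p) ^ 2 : ℝ)) : ℂ)) * (τw : ℂ) *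
            (Complex.I * gamC kw (α + (2 * π / d) * p))) * UW.2 p = Qd p ∧
        -(τu : ℂ) * Complex.I * gamC ku (α + (2 * π / d) * p) * UW.1 p
          - (τw : ℂ) * Complex.I * gamC kw (α + (2 * π / d) * p) * UW.2 p = Rd p) ∧
      ∀ U W : ℤ → ℂ,
        (∀ p : ℤ,
          U p + (-1 - ((X₀ : ℂ) / (Complex.I * (k₀ : ℂ))) *
              (σl + σn * ((((α + (2 * π / d) * p) ^ 2 : ℝ)) : ℂ)) * (τw : ℂ) *
              (Complex.I * gamC kw (α + (2 * π / d) * p))) * W p = Qd p ∧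
          -(τu : ℂ) * Complex.I * gamC ku (α + (2 * π / d) * p) * U p
            - (τw : ℂ) * Complex.I * gamC kw (α + (2 * π / d) * p) * W p = Rd p) →
        Summable (fun p : ℤ => (1 + |(p : ℝ)| ^ 2) ^ (s + 1) * ‖U p‖ ^ 2) ∧
        Summable (fun p : ℤ => (1 + |(p : ℝ)| ^ 2) ^ (s + 3) * ‖W p‖ ^ 2) ∧
        Real.sqrt (∑' p : ℤ, (1 + |(p : ℝ)| ^ 2) ^ (s + 1) * ‖U p‖ ^ 2)
          ≤ Ce * (Real.sqrt (∑' p : ℤ, (1 + |(p : ℝ)| ^ 2) ^ s * ‖Qd p‖ ^ 2)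
              + Real.sqrt (∑' p : ℤ, (1 + |(p : ℝ)| ^ 2) ^ s * ‖Rd p‖ ^ 2)) ∧
        Real.sqrt (∑' p : ℤ, (1 + |(p : ℝ)| ^ 2) ^ (s + 3) * ‖W p‖ ^ 2)
          ≤ Ce * (Real.sqrt (∑' p : ℤ, (1 + |(p : ℝ)| ^ 2) ^ s * ‖Qd p‖ ^ 2)
              + Real.sqrt (∑' p : ℤ, (1 + |(p : ℝ)| ^ 2) ^ s * ‖Rd p‖ ^ 2)) := by
  have hσn0 : σn ≠ 0 := by
    rw [hσn, hσl, hQ]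
    exact mul_ne_zero (drude_local_ne_zero hEF he hε₀ hc₀ hΓ) (nonlocal_factor_ne_zero hf hvF)
  obtain ⟨c, hc, hΔ⟩ :=
    exists_mul_le_norm_DeltaTM hd hku hkw hk₀ hτu hτw hX₀ hσn0 hμ hres
  set A : ℤ → ℂ := fun p => -1 - ((X₀ : ℂ) / (Complex.I * (k₀ : ℂ))) *
    (σl + σn * ((((α + (2 * π / d) * p) ^ 2 : ℝ)) : ℂ)) * (τw : ℂ) *
    (Complex.I * gamC kw (α + (2 * π / d) * p)) with hA
  set B : ℤ → ℂ := fun p => -(τu : ℂ) * Complex.I * gamC ku (α + (2 * π / d) * p) with hB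
  set D : ℤ → ℂ := fun p => -((τw : ℂ) * Complex.I * gamC kw (α + (2 * π / d) * p)) with hD
  have hdet : ∀ p, DeltaTM d α ku kw k₀ X₀ τu τw σl σn p = D p - B p * A p := by
    intro p
    rw [DeltaTM_eq]
    simp only [hA, hB, hD]
    linear_combination ((τu : ℂ) * (τw : ℂ) * ((X₀ : ℂ) / (Complex.I * (k₀ : ℂ))) *
        (gamC ku (α + (2 * π / d) * p) * gamC kw (α + (2 * π / d) * p)) *
        (σl + σn * ((((α + (2 * π / d) * p) ^ 2 : ℝ)) : ℂ))) * Complex.I_sq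
  have hdet0 : ∀ p, D p - B p * A p ≠ 0 := fun p => by
    rw [← hdet, ← norm_pos_iff]
    exact hμ.trans_le (hres p)
  have hsys : ∀ (u w q r : ℂ) (p : ℤ), (u + (-1 - ((X₀ : ℂ) / (Complex.I * (k₀ : ℂ))) *
      (σl + σn * ((((α + (2 * π / d) * p) ^ 2 : ℝ)) : ℂ)) * (τw : ℂ) *
      (Complex.I * gamC kw (α + (2 * π / d) * p))) * w = q ∧
      -(τu : ℂ) * Complex.I * gamC ku (α + (2 * π / d) * p) * u
        - (τw : ℂ) * Complex.I * gamC kw (α + (2 * π / d) * p) * w = r) ↔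
      u = (D p * q - A p * r) / (D p - B p * A p) ∧
        w = (r - B p * q) / (D p - B p * A p) := by
    intro u w q r p
    rw [← two_by_two_solution_iff (hdet0 p)]
    simp only [hA, hB, hD, neg_mul, sub_eq_add_neg]
  obtain ⟨L, hL1, hbounds⟩ := exists_coefficient_bounds d α ku kw
    ((X₀ : ℂ) / (Complex.I * (k₀ : ℂ))) σl σn hτu.le hτw.le
  refine ⟨2 * L / c, by positivity, fun Qd Rd hQs hRs => ⟨?_, fun U W hUW => ?_⟩⟩
  · refine ⟨(fun p => (D p * Qd p - A p * Rd p) / (D p - B p * A p),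
      fun p => (Rd p - B p * Qd p) / (D p - B p * A p)), fun p => (hsys _ _ _ _ p).2 ⟨rfl, rfl⟩,
      fun UW h => ?_⟩
    exact Prod.ext (funext fun p => ((hsys _ _ _ _ p).1 (h p)).1)
      (funext fun p => ((hsys _ _ _ _ p).1 (h p)).2)
  · have hdecay : ∀ p : ℤ,
        (1 + |(p : ℝ)| ^ 2) ^ (1 : ℝ) * ‖U p‖ ^ 2 ≤
          (2 * L / c) ^ 2 * (‖Qd p‖ ^ 2 + ‖Rd p‖ ^ 2) ∧
        (1 + |(p : ℝ)| ^ 2) ^ (3 : ℝ) * ‖W p‖ ^ 2 ≤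
          (2 * L / c) ^ 2 * (‖Qd p‖ ^ 2 + ‖Rd p‖ ^ 2) := by
      intro p
      obtain ⟨hU, hW⟩ := (hsys _ _ _ _ p).1 (hUW p)
      obtain ⟨hAp, hBp, hDp⟩ := hbounds p
      have hΔp := hΔ p
      have hy2 : √(1 + (p : ℝ) ^ 2) ^ 2 = 1 + (p : ℝ) ^ 2 := Real.sq_sqrt (by positivity)
      have hy1 : 1 ≤ √(1 + (p : ℝ) ^ 2) :=
        Real.one_le_sqrt.2 (by nlinarith [sq_nonneg (p : ℝ)])
      rw [hdet] at hΔp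
      rw [sq_abs, Real.rpow_one, show (3 : ℝ) = ((3 : ℕ) : ℝ) by norm_num, Real.rpow_natCast]
      rw [← hy2] at hΔp ⊢
      generalize √(1 + (p : ℝ) ^ 2) = y at hAp hBp hDp hΔp hy1 ⊢
      have hy0 : 0 < y := by linarith
      rw [← pow_mul] at hΔp
      constructor
      · have h := sq_mul_norm_div_sq_le (y := y) (n := 1) (j := 3) (x := U p) (a := D p)
          (b := -A p) (q := Qd p) (r := Rd p) (M := L) hy0 hc (by rw [hU]; ring)
          (hDp.trans (by gcongr; exact le_self_pow₀ hy1 (by norm_num)))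
          (by rwa [norm_neg]) hΔp (by linarith)
        rwa [pow_one] at h
      · have h := sq_mul_norm_div_sq_le (y := y) (n := 3) (j := 1) (x := W p) (a := -B p)
          (b := 1) (q := Qd p) (r := Rd p) (M := L) hy0 hc (by rw [hW]; ring)
          (by rwa [norm_neg, pow_one]) (by rw [norm_one, pow_one]; exact one_le_mul_of_one_le_of_one_le hL1 hy1) hΔp
          (by linarith)
        rwa [pow_right_comm] at h
    have hC : 0 ≤ 2 * L / c := by positivity
    obtain ⟨hU1, hU2⟩ := sobolev_estimate hC hQs hRs fun p => (hdecay p).1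
    obtain ⟨hW1, hW2⟩ := sobolev_estimate hC hQs hRs fun p => (hdecay p).2
    exact ⟨hU1, hW1, hU2, hW2⟩
end

section
/- Let the physical parameters E_F, e, ε₀, c₀, Γ, h, f, v_F, τ, k₀, k_u, k_w, d, τ_u, τ_w be positive and X₀ ≠ 0 real. Then there exist c > 0 and N ∈ ℕ such that |Δ^TM_p| ≥ c⟨p⟩⁴ for all p with |p| ≥ N. Consequently, if in addition inf_{p∈ℤ} |Δ^TM_p| > 0, there is a constant C > 0 with 1/|Δ^TM_p| ≤ C⟨p⟩^{−4} for all p ∈ ℤ. -/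
open Real Complex

/-- Beyond the cutoff `2k`, the vertical wavenumber is comparable to `|a|`. -/
lemma norm_gamC_bounds {k a : ℝ} (hk : 0 < k) (ha : 2 * k ≤ |a|) :
    |a| / 2 ≤ ‖gamC k a‖ ∧ ‖gamC k a‖ ≤ |a| := by
  have hsq : 4 * k ^ 2 ≤ a ^ 2 := by
    rw [← sq_abs a]
    nlinarith
  have hlt : ¬ a ^ 2 ≤ k ^ 2 := by nlinarith [pow_pos hk 2]
  have hnorm : ‖gamC k a‖ = √(a ^ 2 - k ^ 2) := by
    rw [gamC, if_neg hlt, norm_mul, Complex.norm_I, one_mul, Complex.norm_real,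
      Real.norm_of_nonneg (Real.sqrt_nonneg _)]
  rw [hnorm]
  refine ⟨Real.le_sqrt_of_sq_le ?_, (Real.sqrt_le_left (abs_nonneg a)).2 ?_⟩
  · rw [div_pow, sq_abs]
    nlinarith
  · rw [sq_abs]
    nlinarith [sq_nonneg k]

/-- A combination of vertical wavenumbers whose top coefficient `B` is nonzero grows at least
quartically in the tangential wavenumber. -/
lemma exists_quartic_le_norm {ku kw : ℝ} (hku : 0 < ku) (hkw : 0 < kw) (U W A : ℂ) {B : ℂ}
    (hB : B ≠ 0) :
    ∃ c : ℝ, 0 < c ∧ ∃ R : ℝ, 0 < R ∧ ∀ a : ℝ, R ≤ |a| →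
      c * |a| ^ 4 ≤ ‖U * gamC ku a + W * gamC kw a + A * (gamC ku a * gamC kw a)
        + B * (gamC ku a * gamC kw a) * ((a ^ 2 : ℝ) : ℂ)‖ := by
  have hb : 0 < ‖B‖ := norm_pos_iff.2 hB
  set M : ℝ := ‖A‖ + ‖U‖ + ‖W‖ with hM
  have hM0 : 0 ≤ M := by positivity
  refine ⟨‖B‖ / 8, by positivity, 1 + 2 * ku + 2 * kw + 8 * M / ‖B‖, by positivity,
    fun a ha => ?_⟩
  have hq : 0 ≤ 8 * M / ‖B‖ := by positivity
  obtain ⟨hul, huu⟩ := norm_gamC_bounds (a := a) hku (by linarith)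
  obtain ⟨hwl, hwu⟩ := norm_gamC_bounds (a := a) hkw (by linarith)
  set x : ℝ := |a|
  have hx1 : 1 ≤ x := by linarith
  have hMx : 8 * M ≤ ‖B‖ * x := by
    have : 8 * M / ‖B‖ ≤ x := by linarith
    rwa [div_le_iff₀' hb] at this
  set u := gamC ku a
  set w := gamC kw a
  have hprodl : x ^ 2 / 4 ≤ ‖u‖ * ‖w‖ := by
    calc x ^ 2 / 4 = x / 2 * (x / 2) := by ring
      _ ≤ ‖u‖ * ‖w‖ := by gcongr
  have hprodu : ‖u‖ * ‖w‖ ≤ x ^ 2 := by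
    calc ‖u‖ * ‖w‖ ≤ x * x := by gcongr
      _ = x ^ 2 := by ring
  have hxx : x ≤ x ^ 2 := by nlinarith
  have hmain : ‖B‖ * x ^ 4 / 4 ≤ ‖B * (u * w) * ((a ^ 2 : ℝ) : ℂ)‖ := by
    have : ‖((a ^ 2 : ℝ) : ℂ)‖ = x ^ 2 := by
      rw [Complex.norm_real, norm_pow, Real.norm_eq_abs]
    rw [norm_mul, norm_mul, norm_mul, this]
    calc ‖B‖ * x ^ 4 / 4 = ‖B‖ * (x ^ 2 / 4) * x ^ 2 := by ring
      _ ≤ ‖B‖ * (‖u‖ * ‖w‖) * x ^ 2 := by gcongr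
  have hrest : ‖U * u + W * w + A * (u * w)‖ ≤ M * x ^ 2 := by
    calc ‖U * u + W * w + A * (u * w)‖ ≤ ‖U * u‖ + ‖W * w‖ + ‖A * (u * w)‖ := norm_add₃_le
      _ = ‖U‖ * ‖u‖ + ‖W‖ * ‖w‖ + ‖A‖ * (‖u‖ * ‖w‖) := by simp only [norm_mul]
      _ ≤ ‖U‖ * x ^ 2 + ‖W‖ * x ^ 2 + ‖A‖ * x ^ 2 := by
        gcongr
        · exact huu.trans hxx
        · exact hwu.trans hxx
      _ = M * x ^ 2 := by rw [hM]; ring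
  have habsorb : M * x ^ 2 ≤ ‖B‖ * x ^ 4 / 8 := by
    have h1 : 8 * M ≤ ‖B‖ * x ^ 2 := hMx.trans (by gcongr)
    nlinarith [mul_le_mul_of_nonneg_right h1 (sq_nonneg x)]
  have htri := norm_sub_le_norm_add (B * (u * w) * ((a ^ 2 : ℝ) : ℂ))
    (U * u + W * w + A * (u * w))
  rw [add_comm (B * (u * w) * ((a ^ 2 : ℝ) : ℂ))] at htri
  linarith

/-- Quartic growth in an affine function of `p` is quartic growth in `p`. -/
lemma exists_quartic_le_of_affine {α β c R : ℝ} (hβ : 0 < β) (hc : 0 < c) {F : ℤ → ℝ}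
    (hF : ∀ p : ℤ, R ≤ |α + β * p| → c * |α + β * p| ^ 4 ≤ F p) :
    ∃ c' : ℝ, 0 < c' ∧ ∃ N : ℕ, ∀ p : ℤ, (N : ℤ) ≤ |p| →
      c' * (1 + |(p : ℝ)| ^ 2) ^ 2 ≤ F p := by
  refine ⟨c * (β / 2) ^ 4 / 4, by positivity, ⌈2 * (|α| + |R|) / β⌉₊ + 1, fun p hp => ?_⟩
  have hp' : 2 * (|α| + |R|) / β + 1 ≤ |(p : ℝ)| := by
    have h1 : ((⌈2 * (|α| + |R|) / β⌉₊ + 1 : ℕ) : ℝ) ≤ |(p : ℝ)| := by exact_mod_cast hp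
    push_cast at h1
    linarith [Nat.le_ceil (2 * (|α| + |R|) / β)]
  set y : ℝ := |(p : ℝ)|
  have hy1 : 1 ≤ y := by
    have : 0 ≤ 2 * (|α| + |R|) / β := by positivity
    linarith
  have hy : 2 * (|α| + |R|) ≤ β * y := by
    have : 2 * (|α| + |R|) / β ≤ y := by linarith
    rwa [div_le_iff₀' hβ] at this
  have htri : β * y - |α| ≤ |α + β * p| := by
    have h1 := abs_sub_abs_le_abs_add (β * (p : ℝ)) α
    rwa [abs_mul, abs_of_pos hβ, add_comm] at h1
  have hlow : β / 2 * y ≤ |α + β * p| := by linarith [abs_nonneg R]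
  refine le_trans ?_ (hF p (by linarith [le_abs_self R, abs_nonneg α]))
  calc c * (β / 2) ^ 4 / 4 * (1 + y ^ 2) ^ 2
      ≤ c * (β / 2) ^ 4 / 4 * (2 * y ^ 2) ^ 2 := by
        gcongr
        nlinarith
    _ = c * (β / 2 * y) ^ 4 := by ring
    _ ≤ c * |α + β * p| ^ 4 := by gcongr

/-- Eventual quartic growth and a positive uniform lower bound give a global quartic decay of the
reciprocal. -/
lemma exists_one_div_le_of_eventually_quartic {F : ℤ → ℝ} {c μ : ℝ} {N : ℕ} (hc : 0 < c)
    (hμ : 0 < μ) (hF : ∀ p : ℤ, (N : ℤ) ≤ |p| → c * (1 + |(p : ℝ)| ^ 2) ^ 2 ≤ F p)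
    (hFμ : ∀ p, μ ≤ F p) :
    ∃ C : ℝ, 0 < C ∧ ∀ p : ℤ, 1 / F p ≤ C / (1 + |(p : ℝ)| ^ 2) ^ 2 := by
  refine ⟨1 / c + (1 + (N : ℝ) ^ 2) ^ 2 / μ, by positivity, fun p => ?_⟩
  have hFp : 0 < F p := hμ.trans_le (hFμ p)
  rw [div_le_div_iff₀ hFp (by positivity), one_mul, add_mul]
  rcases le_total (N : ℤ) |p| with hp | hp
  · have h1 : (1 + |(p : ℝ)| ^ 2) ^ 2 ≤ 1 / c * F p := by
      rw [one_div, inv_mul_eq_div, le_div_iff₀ hc, mul_comm]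
      exact hF p hp
    have h2 : 0 ≤ (1 + (N : ℝ) ^ 2) ^ 2 / μ * F p := by positivity
    linarith
  · have hpN : |(p : ℝ)| ≤ N := by exact_mod_cast hp
    have h1 : (1 + |(p : ℝ)| ^ 2) ^ 2 ≤ (1 + (N : ℝ) ^ 2) ^ 2 / μ * F p := by
      calc (1 + |(p : ℝ)| ^ 2) ^ 2 ≤ (1 + (N : ℝ) ^ 2) ^ 2 := by gcongr
        _ = (1 + (N : ℝ) ^ 2) ^ 2 / μ * μ := by field_simp
        _ ≤ _ := by
          gcongr
          exact hFμ p
    have h2 : 0 ≤ 1 / c * F p := by positivity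
    linarith

/-- A complex number with nonzero real part is nonzero. -/
lemma ne_zero_of_re_ne_zero {z : ℂ} (hz : z.re ≠ 0) : z ≠ 0 := fun h0 => hz (by simp [h0])

/-- with the physical BGK conductivities and `X₀ ≠ 0`, the TM
determinant grows quartically: `|Δ^TM_p| ≥ c⟨p⟩⁴` for all large `|p|`;
consequently, if moreover `inf_p |Δ^TM_p| > 0`, then `1/|Δ^TM_p| ≤ C⟨p⟩^{−4}`
for all `p`. -/
theorem DeltaTM_growth (d α ku kw k₀ X₀ τu τw : ℝ)
    (hd : 0 < d) (hku : 0 < ku) (hkw : 0 < kw) (hk₀ : 0 < k₀)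
    (hτu : 0 < τu) (hτw : 0 < τw) (hX₀ : X₀ ≠ 0)
    (EF e ε₀ c₀ Γ h f vF τ : ℝ)
    (hEF : 0 < EF) (he : 0 < e) (hε₀ : 0 < ε₀) (hc₀ : 0 < c₀)
    (hΓ : 0 < Γ) (hh : 0 < h) (hf : 0 < f) (hvF : 0 < vF) (hτ : 0 < τ)
    (σl σn Q : ℂ)
    (hσl : σl = ((2 * EF * e ^ 2 / (ε₀ * c₀) : ℝ) : ℂ) /
      ((Γ : ℂ) - Complex.I * (h : ℂ) * (f : ℂ)))
    (hQ : Q = ((vF ^ 2 : ℝ) : ℂ) *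
      ((3 * (f : ℂ) + 2 * Complex.I / (τ : ℂ)) /
        (4 * (f : ℂ) * ((f : ℂ) + Complex.I / (τ : ℂ)) ^ 2)))
    (hσn : σn = σl * Q) :
    (∃ c : ℝ, 0 < c ∧ ∃ N : ℕ, ∀ p : ℤ, (N : ℤ) ≤ |p| →
      c * (1 + |(p : ℝ)| ^ 2) ^ 2 ≤ ‖DeltaTM d α ku kw k₀ X₀ τu τw σl σn p‖) ∧
    ((∃ μ : ℝ, 0 < μ ∧ ∀ p : ℤ, μ ≤ ‖DeltaTM d α ku kw k₀ X₀ τu τw σl σn p‖) →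
      ∃ C : ℝ, 0 < C ∧ ∀ p : ℤ,
        1 / ‖DeltaTM d α ku kw k₀ X₀ τu τw σl σn p‖ ≤ C / (1 + |(p : ℝ)| ^ 2) ^ 2) := by
  have hσl0 : σl ≠ 0 := by
    rw [hσl]
    refine div_ne_zero (Complex.ofReal_ne_zero.2 (by positivity)) (ne_zero_of_re_ne_zero ?_)
    simpa using hΓ.ne'
  have hQ0 : Q ≠ 0 := by
    have hnum : 3 * (f : ℂ) + 2 * Complex.I / (τ : ℂ) ≠ 0 :=
      ne_zero_of_re_ne_zero (by simpa [Complex.div_ofReal_re] using hf.ne')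
    have hden : (f : ℂ) + Complex.I / (τ : ℂ) ≠ 0 :=
      ne_zero_of_re_ne_zero (by simpa [Complex.div_ofReal_re] using hf.ne')
    have hf0 : (f : ℂ) ≠ 0 := Complex.ofReal_ne_zero.2 hf.ne'
    rw [hQ]
    exact mul_ne_zero (Complex.ofReal_ne_zero.2 (by positivity))
      (div_ne_zero hnum (mul_ne_zero (mul_ne_zero (by norm_num) hf0) (pow_ne_zero 2 hden)))
  have hB : (τu : ℂ) * (τw : ℂ) * (σn / (Complex.I * (k₀ : ℂ))) * (X₀ : ℂ) ≠ 0 := by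
    have hσn0 : σn ≠ 0 := hσn ▸ mul_ne_zero hσl0 hQ0
    have hk₀' : Complex.I * (k₀ : ℂ) ≠ 0 :=
      mul_ne_zero Complex.I_ne_zero (Complex.ofReal_ne_zero.2 hk₀.ne')
    exact mul_ne_zero (mul_ne_zero (mul_ne_zero (Complex.ofReal_ne_zero.2 hτu.ne')
      (Complex.ofReal_ne_zero.2 hτw.ne')) (div_ne_zero hσn0 hk₀')) (Complex.ofReal_ne_zero.2 hX₀)
  obtain ⟨c, hc, R, -, hR⟩ := exists_quartic_le_norm hku hkw (-(τu : ℂ) * Complex.I)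
    (-(τw : ℂ) * Complex.I) ((τu : ℂ) * (τw : ℂ) * (σl / (Complex.I * (k₀ : ℂ))) * (X₀ : ℂ)) hB
  have hgrowth := exists_quartic_le_of_affine (α := α) (β := 2 * π / d) (R := R)
    (F := fun p => ‖DeltaTM d α ku kw k₀ X₀ τu τw σl σn p‖) (by positivity) hc
    (fun p hp => (hR _ hp).trans_eq (congrArg norm (by rw [DeltaTM]; ring)))
  refine ⟨hgrowth, ?_⟩
  rintro ⟨μ, hμ, hΔμ⟩
  obtain ⟨c', hc', N, hN⟩ := hgrowth
  exact exists_one_div_le_of_eventually_quartic hc' hμ hN hΔμ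
end
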